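/- For p, q₁, q₂ ∈ P, let m = q₁^{1/2} · exp((1/2)·log(q₁^{−1/2} q₂ q₁^{−1/2})) · q₁^{1/2} be the geodesic midpoint of q₁ and q₂. Then d(p, q₁)² + d(p, q₂)² ≥ (1/2)·d(q₁, q₂)² + 2·d(p, m)². (The semi-parallelogram law expressing the non-positive curvature of P.) -/

import Mathlib

noncomputable section

open scoped InnerProductSpace

variable {H : Type*} [NormedAddCommGroup H] [InnerProductSpace ℂ H] [CompleteSpace H]
variable {ι : Type*}

/-- `A` is a Hilbert–Schmidt operator (w.r.t. the Hilbert basis `e`). -/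
def IsHS (e : HilbertBasis ι ℂ H) (A : H →L[ℂ] H) : Prop :=
  Summable fun i => ‖A (e i)‖ ^ 2

/-- The Hilbert–Schmidt norm of `A` (w.r.t. the Hilbert basis `e`). -/
def hsNorm (e : HilbertBasis ι ℂ H) (A : H →L[ℂ] H) : ℝ :=
  Real.sqrt (∑' i, ‖A (e i)‖ ^ 2)

/-- The real Hilbert–Schmidt inner product `⟨A, B⟩₂ = ∑ ⟪A eᵢ, B eᵢ⟫`. -/
def hsInner (e : HilbertBasis ι ℂ H) (A B : H →L[ℂ] H) : ℝ :=
  (∑' i, (inner ℂ (A (e i)) (B (e i)) : ℂ)).re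

/-- The trace of an operator, `Tr T = ∑ ⟪eᵢ, T eᵢ⟫`. -/
def opTrace (e : HilbertBasis ι ℂ H) (T : H →L[ℂ] H) : ℂ :=
  ∑' i, (inner ℂ (e i) (T (e i)) : ℂ)

/-- `T` is trace class: it is the product of two Hilbert–Schmidt operators. -/
def IsTraceClass (e : HilbertBasis ι ℂ H) (T : H →L[ℂ] H) : Prop :=
  ∃ B C : H →L[ℂ] H, IsHS e B ∧ IsHS e C ∧ T = B * C

/-- `A ∈ S₂(H)`: self-adjoint and Hilbert–Schmidt. -/
def MemS2 (e : HilbertBasis ι ℂ H) (A : H →L[ℂ] H) : Prop :=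
  IsSelfAdjoint A ∧ IsHS e A

/-- `p ∈ P`: self-adjoint, positive definite (invertible and `⟪p x, x⟫ ≥ 0`),
with `p - 1` Hilbert–Schmidt. -/
def MemP (e : HilbertBasis ι ℂ H) (p : H →L[ℂ] H) : Prop :=
  IsSelfAdjoint p ∧ IsUnit p ∧ (∀ x : H, 0 ≤ (inner ℂ (p x) x : ℂ).re) ∧ IsHS e (p - 1)

/-- `x ∈ GL₂(H)`: invertible with `x - 1` Hilbert–Schmidt. -/
def MemGL2 (e : HilbertBasis ι ℂ H) (x : H →L[ℂ] H) : Prop :=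
  IsUnit x ∧ IsHS e (x - 1)

/-- `x ∈ U₂(H)`: unitary with `x - 1` Hilbert–Schmidt. -/
def MemU2 (e : HilbertBasis ι ℂ H) (x : H →L[ℂ] H) : Prop :=
  x ∈ unitary (H →L[ℂ] H) ∧ IsHS e (x - 1)

/-- `p^{1/2}`, via continuous functional calculus. -/
def psqrt (p : H →L[ℂ] H) : H →L[ℂ] H := cfc Real.sqrt p

/-- `p^{-1/2}`, via continuous functional calculus. -/
def pinvsqrt (p : H →L[ℂ] H) : H →L[ℂ] H := cfc (fun t : ℝ => (Real.sqrt t)⁻¹) p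

/-- `log p`, via continuous functional calculus. -/
def plog (p : H →L[ℂ] H) : H →L[ℂ] H := cfc Real.log p

/-- The geodesic distance `d(p, q) = ‖log (p^{-1/2} q p^{-1/2})‖₂`. -/
def gdist (e : HilbertBasis ι ℂ H) (p q : H →L[ℂ] H) : ℝ :=
  hsNorm e (plog (pinvsqrt p * q * pinvsqrt p))

/-- The commutator `[A, B] = AB - BA`. -/
def brk (A B : H →L[ℂ] H) : H →L[ℂ] H := A * B - B * A

/-- The constant-speed geodesic `t ↦ p^{1/2} exp(t K) p^{1/2}`. -/
def geoCurve (p K : H →L[ℂ] H) (t : ℝ) : H →L[ℂ] H :=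
  psqrt p * NormedSpace.exp (t • K) * psqrt p

/-- The geodesic from `p` to `q`:
`t ↦ p^{1/2} exp(t log(p^{-1/2} q p^{-1/2})) p^{1/2}`. -/
def geodesic (p q : H →L[ℂ] H) (t : ℝ) : H →L[ℂ] H :=
  geoCurve p (plog (pinvsqrt p * q * pinvsqrt p)) t

/-- The image `exp E` of a set of operators under the exponential map. -/
def expSet (E : Set (H →L[ℂ] H)) : Set (H →L[ℂ] H) := NormedSpace.exp '' E

/-- The orthogonal complement of `E` inside `S₂(H)` for the Hilbert–Schmidt
inner product. -/
def hsPerp (e : HilbertBasis ι ℂ H) (E : Set (H →L[ℂ] H)) : Set (H →L[ℂ] H) :=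
  {Y | MemS2 e Y ∧ ∀ X ∈ E, hsInner e X Y = 0}

/-- `E` is closed in `S₂(H)` with respect to the Hilbert–Schmidt norm. -/
def IsHSClosed (e : HilbertBasis ι ℂ H) (E : Set (H →L[ℂ] H)) : Prop :=
  ∀ X : H →L[ℂ] H, MemS2 e X → (∀ ε > (0:ℝ), ∃ Y ∈ E, hsNorm e (X - Y) < ε) → X ∈ E

set_option linter.unusedSectionVars false
set_option linter.deprecated false
open scoped ENNReal
open Filter Topology

/-! ### Hilbert–Schmidt basics -/

lemma hb_parseval {κ : Type*} (f : HilbertBasis κ ℂ H) (x : H) :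
    HasSum (fun i => ‖(inner ℂ (f i) x : ℂ)‖ ^ 2) (‖x‖ ^ 2) := by
  have h := f.hasSum_inner_mul_inner x x
  have h2 := Complex.hasSum_re h
  have h3 : ((inner ℂ x x : ℂ)).re = ‖x‖ ^ 2 := by
    rw [inner_self_eq_norm_sq_to_K]; norm_cast
  rw [h3] at h2
  convert h2 using 2 with i
  rw [← inner_conj_symm x (f i), RCLike.conj_mul]
  norm_cast

lemma hb_parsevalE {κ : Type*} (f : HilbertBasis κ ℂ H) (x : H) :
    ∑' i, ENNReal.ofReal (‖(inner ℂ (f i) x : ℂ)‖ ^ 2) = ENNReal.ofReal (‖x‖ ^ 2) := by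
  rw [← (hb_parseval f x).tsum_eq, ENNReal.ofReal_tsum_of_nonneg (fun _ => by positivity)
    (hb_parseval f x).summable]

/-- Extended Hilbert–Schmidt norm squared. -/
def hsE {κ : Type*} (e : HilbertBasis κ ℂ H) (A : H →L[ℂ] H) : ℝ≥0∞ :=
  ∑' i, ENNReal.ofReal (‖A (e i)‖ ^ 2)

lemma hsE_adjoint {κ κ' : Type*} (e : HilbertBasis κ ℂ H) (f : HilbertBasis κ' ℂ H)
    (A : H →L[ℂ] H) : hsE e A = hsE f (star A) := by
  unfold hsE
  simp_rw [← hb_parsevalE f (A _), ← hb_parsevalE e (star A _)]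
  rw [ENNReal.tsum_comm]
  congr! 5 with i j
  rw [ContinuousLinearMap.star_eq_adjoint, ContinuousLinearMap.adjoint_inner_right,
    ← inner_conj_symm, RCLike.norm_conj]

lemma hsE_basis {κ κ' : Type*} (e : HilbertBasis κ ℂ H) (f : HilbertBasis κ' ℂ H)
    (A : H →L[ℂ] H) : hsE e A = hsE f A := by
  rw [hsE_adjoint e f A, hsE_adjoint f f A]

lemma isHS_iff {κ : Type*} (e : HilbertBasis κ ℂ H) (A : H →L[ℂ] H) :
    IsHS e A ↔ hsE e A ≠ ∞ := by
  constructor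
  · intro h
    exact h.tsum_ofReal_ne_top
  · intro h
    have := ENNReal.summable_toReal h
    refine this.congr fun i => ?_
    rw [ENNReal.toReal_ofReal (by positivity)]

lemma hsNorm_eq {κ : Type*} (e : HilbertBasis κ ℂ H) (A : H →L[ℂ] H) :
    hsNorm e A = Real.sqrt (hsE e A).toReal := by
  unfold hsNorm hsE
  rw [ENNReal.tsum_toReal_eq (fun _ => ENNReal.ofReal_ne_top)]
  congr! 3 with i
  rw [ENNReal.toReal_ofReal (by positivity)]

lemma hsNorm_nonneg {κ : Type*} (e : HilbertBasis κ ℂ H) (A : H →L[ℂ] H) : 0 ≤ hsNorm e A :=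
  Real.sqrt_nonneg _

lemma hsNorm_sq {κ : Type*} (e : HilbertBasis κ ℂ H) (A : H →L[ℂ] H) :
    hsNorm e A ^ 2 = ∑' i, ‖A (e i)‖ ^ 2 :=
  Real.sq_sqrt (tsum_nonneg fun _ => by positivity)

lemma isHS_basis {κ κ' : Type*} (e : HilbertBasis κ ℂ H) (f : HilbertBasis κ' ℂ H)
    {A : H →L[ℂ] H} (h : IsHS e A) : IsHS f A := by
  rw [isHS_iff] at *; rwa [hsE_basis f e]

lemma hsNorm_basis {κ κ' : Type*} (e : HilbertBasis κ ℂ H) (f : HilbertBasis κ' ℂ H)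
    (A : H →L[ℂ] H) : hsNorm e A = hsNorm f A := by
  rw [hsNorm_eq, hsNorm_eq, hsE_basis e f]

lemma isHS_star {e : HilbertBasis ι ℂ H} {A : H →L[ℂ] H} (h : IsHS e A) : IsHS e (star A) := by
  rw [isHS_iff] at *; rwa [hsE_adjoint e e, star_star]

lemma isHS_of_le {e : HilbertBasis ι ℂ H} {A B : H →L[ℂ] H} (c : ℝ)
    (h : ∀ v, ‖A v‖ ≤ c * ‖B v‖) (hB : IsHS e B) : IsHS e A := by
  refine Summable.of_nonneg_of_le (fun _ => by positivity) (fun i => ?_) (hB.mul_left (c ^ 2))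
  rw [← mul_pow]
  exact pow_le_pow_left₀ (norm_nonneg _) (h _) 2

lemma hsNorm_le_of_le {e : HilbertBasis ι ℂ H} {A B : H →L[ℂ] H} {c : ℝ} (hc : 0 ≤ c)
    (h : ∀ v, ‖A v‖ ≤ c * ‖B v‖) (hB : IsHS e B) : hsNorm e A ≤ c * hsNorm e B := by
  have hA := isHS_of_le c h hB
  refine (sq_le_sq₀ (hsNorm_nonneg _ _) (mul_nonneg hc (hsNorm_nonneg _ _))).1 ?_
  rw [mul_pow, hsNorm_sq, hsNorm_sq, ← tsum_mul_left]
  refine hA.tsum_le_tsum (fun i => ?_) (hB.mul_left _)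
  rw [← mul_pow]
  exact pow_le_pow_left₀ (norm_nonneg _) (h _) 2

lemma IsHS.mul_left' {e : HilbertBasis ι ℂ H} {A : H →L[ℂ] H} (B : H →L[ℂ] H) (h : IsHS e A) :
    IsHS e (B * A) :=
  isHS_of_le ‖B‖ (fun v => B.le_opNorm (A v)) h

lemma IsHS.mul_right' {e : HilbertBasis ι ℂ H} {A : H →L[ℂ] H} (B : H →L[ℂ] H) (h : IsHS e A) :
    IsHS e (A * B) := by
  have := isHS_star ((isHS_star h).mul_left' (star B))
  simpa using this

lemma IsHS.add' {e : HilbertBasis ι ℂ H} {A B : H →L[ℂ] H} (hA : IsHS e A) (hB : IsHS e B) :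
    IsHS e (A + B) := by
  refine Summable.of_nonneg_of_le (fun _ => by positivity) (fun i => ?_)
    ((Summable.mul_left 2 hA).add (Summable.mul_left 2 hB))
  have := norm_add_le (A (e i)) (B (e i))
  simp only [ContinuousLinearMap.add_apply]
  nlinarith [sq_nonneg (‖A (e i)‖ - ‖B (e i)‖), norm_nonneg (A (e i) + B (e i))]

lemma IsHS.smul' {e : HilbertBasis ι ℂ H} {A : H →L[ℂ] H} (r : ℝ) (hA : IsHS e A) :
    IsHS e (r • A) :=
  isHS_of_le |r| (fun v => by simp [norm_smul]) hA

lemma IsHS.neg' {e : HilbertBasis ι ℂ H} {A : H →L[ℂ] H} (hA : IsHS e A) :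
    IsHS e (-A) :=
  isHS_of_le 1 (fun v => by simp) hA

lemma IsHS.sub' {e : HilbertBasis ι ℂ H} {A B : H →L[ℂ] H} (hA : IsHS e A) (hB : IsHS e B) :
    IsHS e (A - B) := by
  rw [sub_eq_add_neg]; exact hA.add' hB.neg'

lemma hsNorm_smul' (e : HilbertBasis ι ℂ H) (r : ℝ) (A : H →L[ℂ] H) :
    hsNorm e (r • A) = |r| * hsNorm e A := by
  unfold hsNorm
  simp only [ContinuousLinearMap.smul_apply, norm_smul, mul_pow, tsum_mul_left]
  rw [Real.sqrt_mul (by positivity), Real.sqrt_sq (norm_nonneg _), Real.norm_eq_abs]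

lemma hsNorm_neg' (e : HilbertBasis ι ℂ H) (A : H →L[ℂ] H) :
    hsNorm e (-A) = hsNorm e A := by
  unfold hsNorm; simp

lemma norm_unitary_apply {u : H →L[ℂ] H} (hu : u ∈ unitary (H →L[ℂ] H)) (x : H) :
    ‖u x‖ = ‖x‖ := by
  have h : (inner ℂ (u x) (u x) : ℂ) = inner ℂ x x := by
    rw [← ContinuousLinearMap.adjoint_inner_right, ← ContinuousLinearMap.star_eq_adjoint,
      ← ContinuousLinearMap.mul_apply, (Unitary.mem_iff.1 hu).1, ContinuousLinearMap.one_apply]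
  rw [inner_self_eq_norm_sq_to_K, inner_self_eq_norm_sq_to_K] at h
  norm_cast at h
  exact (sq_eq_sq₀ (norm_nonneg _) (norm_nonneg _)).1 (by exact_mod_cast h)

lemma hsE_unitary_mul (e : HilbertBasis ι ℂ H) {u : H →L[ℂ] H} (hu : u ∈ unitary (H →L[ℂ] H))
    (A : H →L[ℂ] H) : hsE e (u * A) = hsE e A := by
  unfold hsE
  simp [norm_unitary_apply hu]

lemma hsNorm_conj (e : HilbertBasis ι ℂ H) {u : H →L[ℂ] H} (hu : u ∈ unitary (H →L[ℂ] H))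
    (A : H →L[ℂ] H) : hsNorm e (u * A * star u) = hsNorm e A := by
  rw [hsNorm_eq, hsNorm_eq, mul_assoc, hsE_unitary_mul e hu, hsE_adjoint e e, star_mul, star_star,
    hsE_unitary_mul e hu, ← hsE_adjoint e e]

lemma hsNorm_le_of_tendsto (e : HilbertBasis ι ℂ H) {A : ℕ → H →L[ℂ] H} {B : H →L[ℂ] H} {c : ℝ}
    (hA : ∀ n, IsHS e (A n)) (hlim : Tendsto A atTop (𝓝 B)) (hc : ∀ n, hsNorm e (A n) ≤ c) :
    hsNorm e B ≤ c := by
  have hc0 : 0 ≤ c := (hsNorm_nonneg _ _).trans (hc 0)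
  refine (sq_le_sq₀ (hsNorm_nonneg _ _) hc0).1 ?_
  rw [hsNorm_sq]
  refine Real.tsum_le_of_sum_le (fun _ => by positivity) fun s => ?_
  have ht : Tendsto (fun n => ∑ i ∈ s, ‖A n (e i)‖ ^ 2) atTop (𝓝 (∑ i ∈ s, ‖B (e i)‖ ^ 2)) := by
    refine tendsto_finset_sum _ fun i _ => ?_
    have : Tendsto (fun n => A n (e i)) atTop (𝓝 (B (e i))) :=
      ((ContinuousLinearMap.apply ℂ H (e i)).continuous.tendsto B).comp hlim
    exact this.norm.pow 2
  refine le_of_tendsto' ht fun n => ?_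
  calc _ ≤ ∑' i, ‖A n (e i)‖ ^ 2 := (hA n).sum_le_tsum _ (fun _ _ => by positivity)
    _ = hsNorm e (A n) ^ 2 := (hsNorm_sq _ _).symm
    _ ≤ c ^ 2 := pow_le_pow_left₀ (hsNorm_nonneg _ _) (hc n) 2

/-! ### Compactness and eigenbases -/

lemma norm_apply_le_of_isHS {e : HilbertBasis ι ℂ H} {A : H →L[ℂ] H} (hA : IsHS e A) :
    ‖A‖ ≤ hsNorm e A := by
  refine A.opNorm_le_bound (hsNorm_nonneg _ _) fun x => ?_
  refine (sq_le_sq₀ (norm_nonneg _) (mul_nonneg (hsNorm_nonneg _ _) (norm_nonneg _))).1 ?_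
  rw [mul_pow, hsNorm_sq]
  have h1 := hb_parseval e (A x)
  have hs := isHS_star hA
  have h2 : ∀ i, ‖(inner ℂ (e i) (A x) : ℂ)‖ ^ 2 ≤ ‖star A (e i)‖ ^ 2 * ‖x‖ ^ 2 := fun i => by
    rw [← ContinuousLinearMap.adjoint_inner_left, ← ContinuousLinearMap.star_eq_adjoint, ← mul_pow]
    exact pow_le_pow_left₀ (norm_nonneg _) (norm_inner_le_norm _ _) 2
  have h3 := hasSum_le h2 h1 (hs.hasSum.mul_right _)
  have h4 : hsNorm e (star A) = hsNorm e A := by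
    rw [hsNorm_eq, hsNorm_eq, ← hsE_adjoint e e]
  rwa [← hsNorm_sq, h4, hsNorm_sq] at h3

lemma isCompactOperator_of_isHS {e : HilbertBasis ι ℂ H} {A : H →L[ℂ] H} (hA : IsHS e A) :
    IsCompactOperator A := by
  classical
  -- finite-rank truncations
  let F : Finset ι → H →L[ℂ] H := fun s =>
    ∑ i ∈ s, (ContinuousLinearMap.toSpanSingleton ℂ (A (e i))).comp (innerSL ℂ (e i))
  have hF : ∀ s x, F s x = ∑ i ∈ s, (inner ℂ (e i) x : ℂ) • A (e i) := fun s x => by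
    simp [F]
  have hFe : ∀ s j, (A - F s) (e j) = if j ∈ s then 0 else A (e j) := fun s j => by
    have horth := orthonormal_iff_ite.1 e.orthonormal
    simp only [ContinuousLinearMap.sub_apply, hF, horth]
    split_ifs with h <;> simp [h]
  have hHS : ∀ s, IsHS e (A - F s) := fun s => by
    refine Summable.of_nonneg_of_le (fun _ => by positivity) (fun i => ?_) hA
    rw [hFe]; split_ifs <;> simp
  have hn : ∀ s, hsNorm e (A - F s) ^ 2 = ∑' i, ‖A (e i)‖ ^ 2 - ∑ i ∈ s, ‖A (e i)‖ ^ 2 := by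
    intro s
    rw [hsNorm_sq]
    have h0 : ∀ j, ‖(A - F s) (e j)‖ ^ 2 = ‖A (e j)‖ ^ 2 - (if j ∈ s then ‖A (e j)‖ ^ 2 else 0) := by
      intro j; rw [hFe]; split_ifs <;> simp
    simp_rw [h0]
    have hfin : HasSum (fun j => if j ∈ s then ‖A (e j)‖ ^ 2 else 0) (∑ i ∈ s, ‖A (e i)‖ ^ 2) := by
      have := hasSum_sum_of_ne_finset_zero (L := SummationFilter.unconditional ι) (f := fun j => if j ∈ s then ‖A (e j)‖ ^ 2 else 0)
        (s := s) (fun b hb => by simp [hb])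
      convert this using 1
      exact Finset.sum_congr rfl (fun i hi => by simp [hi])
    exact ((hA.hasSum).sub hfin).tsum_eq
  have hlim : Tendsto F atTop (𝓝 A) := by
    rw [tendsto_iff_norm_sub_tendsto_zero]
    have h1 : Tendsto (fun s => hsNorm e (A - F s) ^ 2) atTop (𝓝 0) := by
      simp_rw [hn]
      have := (tendsto_const_nhds (x := ∑' i, ‖A (e i)‖ ^ 2)).sub hA.hasSum
      simpa using this
    have h2 : Tendsto (fun s => hsNorm e (A - F s)) atTop (𝓝 0) := by
      have := (Real.continuous_sqrt.tendsto 0).comp h1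
      simpa [Function.comp_def, Real.sqrt_sq (hsNorm_nonneg _ _)] using this
    refine squeeze_zero (fun _ => norm_nonneg _) (fun s => ?_) h2
    rw [norm_sub_rev]
    exact norm_apply_le_of_isHS (hHS s)
  refine isCompactOperator_of_tendsto hlim (Eventually.of_forall fun s => ?_)
  have : ∀ s, F s ∈ compactOperator (RingHom.id ℂ) H H := by
    intro s
    refine Submodule.sum_mem _ fun i _ => ?_
    have hc : IsCompactOperator (innerSL ℂ (e i) : H →L[ℂ] ℂ) :=
      isCompactOperator_of_locallyCompactSpace_dom _
    exact hc.clm_comp (ContinuousLinearMap.toSpanSingleton ℂ (A (e i)))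
  exact this s

lemma exists_eigenbasis {e : HilbertBasis ι ℂ H} {X : H →L[ℂ] H} (hX : IsSelfAdjoint X)
    (hS : IsHS e X) : ∃ (w : Set H) (f : HilbertBasis w ℂ H) (x : w → ℝ),
      ∀ i, X (f i) = (x i : ℂ) • f i := by
  have hc := isCompactOperator_of_isHS hS
  have hsym : X.IsSymmetric := ContinuousLinearMap.isSelfAdjoint_iff_isSymmetric.1 hX
  have hbot := ContinuousLinearMap.orthogonalComplement_iSup_eigenspaces_eq_bot hc hsym
  have hof := LinearMap.IsSymmetric.orthogonalFamily_eigenspaces hsym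
  let V : ℂ → Submodule ℂ H := fun μ => Module.End.eigenspace (X : Module.End ℂ H) μ
  have hcl : ∀ μ, IsClosed (V μ : Set H) := by
    intro μ
    have : (V μ : Set H) = {v | X v = μ • v} := by
      ext v; simp [V]
    rw [this]
    exact isClosed_eq X.continuous (continuous_const_smul μ)
  have : ∀ μ, CompleteSpace (V μ) := fun μ => (hcl μ).completeSpace_coe
  choose w b hb using fun μ => exists_hilbertBasis ℂ (V μ)
  have hon := hof.orthonormal_sigma_orthonormal (v_family := fun μ => ((b μ) : w μ → V μ))
    (fun μ => (b μ).orthonormal)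
  set g : (Σ μ, w μ) → H := fun a => ((b a.1 a.2 : V a.1) : H) with hg
  have hon' : Orthonormal ℂ g := hon
  have hspan : (Submodule.span ℂ (Set.range g))ᗮ = ⊥ := by
    rw [eq_bot_iff, ← hbot]
    intro v hv
    rw [Submodule.mem_orthogonal] at hv
    rw [Submodule.mem_orthogonal']
    intro z hz
    have key : (⨆ μ, V μ) ≤ (Submodule.span ℂ {v})ᗮ := by
      refine iSup_le fun μ y hy => ?_
      rw [Submodule.mem_orthogonal_singleton_iff_inner_right]
      have h1 := (b μ).hasSum_repr ⟨y, hy⟩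
      have h2 := h1.mapL ((innerSL ℂ v).comp (V μ).subtypeL)
      have h3 : ∀ i, ((innerSL ℂ v).comp (V μ).subtypeL) ((b μ).repr ⟨y, hy⟩ i • b μ i) = 0 := by
        intro i
        have h4 : (inner ℂ (g ⟨μ, i⟩) v : ℂ) = 0 := hv _ (Submodule.subset_span ⟨⟨μ, i⟩, rfl⟩)
        have h5 : (inner ℂ v (g ⟨μ, i⟩) : ℂ) = 0 := inner_eq_zero_symm.1 h4
        rw [map_smul]
        simp only [ContinuousLinearMap.comp_apply, Submodule.subtypeL_apply, innerSL_apply_apply]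
        rw [show (inner ℂ v ((b μ i : V μ) : H) : ℂ) = 0 from h5, smul_zero]
      simp_rw [h3] at h2
      exact (h2.unique hasSum_zero)
    have := key hz
    rwa [Submodule.mem_orthogonal_singleton_iff_inner_right] at this
  have hon2 : Orthonormal ℂ ((↑) : Set.range g → H) := hon'.toSubtypeRange
  have hspan2 : (Submodule.span ℂ (Set.range ((↑) : Set.range g → H)))ᗮ = ⊥ := by
    rwa [Subtype.range_coe]
  refine ⟨Set.range g, HilbertBasis.mkOfOrthogonalEqBot hon2 hspan2,
    fun i => (Classical.choose i.2).1.re, fun i => ?_⟩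
  rw [HilbertBasis.coe_mkOfOrthogonalEqBot]
  have hi := Classical.choose_spec i.2
  set a := Classical.choose i.2 with ha
  have hev : X (i : H) = a.1 • (i : H) := by
    have := (b a.1 a.2).2
    rw [Module.End.mem_eigenspace_iff] at this
    rw [← hi]
    exact this
  have hreal : ((a.1.re : ℝ) : ℂ) = a.1 := by
    have hv : Module.End.HasEigenvalue (X : Module.End ℂ H) a.1 := by
      refine Module.End.hasEigenvalue_of_hasEigenvector (x := (i : H)) ⟨?_, ?_⟩
      · rw [Module.End.mem_eigenspace_iff]; exact hev
      · intro h0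
        have := hon2.1 i
        rw [h0] at this; simp at this
    exact Complex.conj_eq_iff_re.1 (hsym.conj_eigenvalue_eq_self hv)
  rw [hreal]
  exact hev

/-! ### Functional calculus -/

lemma re_inner_cfc_nonneg {A : H →L[ℂ] H} {h : ℝ → ℝ}
    (hh : ∀ x ∈ spectrum ℝ A, 0 ≤ h x) (v : H) : 0 ≤ (inner ℂ v (cfc h A v) : ℂ).re := by
  have h1 : 0 ≤ cfc h A := cfc_nonneg hh
  rw [ContinuousLinearMap.nonneg_iff_isPositive] at h1
  exact (Complex.le_def.1 (h1.inner_nonneg_right v)).1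

lemma norm_sq_eq_re_inner {A : H →L[ℂ] H} (hA : IsSelfAdjoint A) (v : H) :
    ‖A v‖ ^ 2 = (inner ℂ v ((A * A) v) : ℂ).re := by
  rw [ContinuousLinearMap.mul_apply, ← ContinuousLinearMap.adjoint_inner_left,
    ← ContinuousLinearMap.star_eq_adjoint, hA.star_eq, inner_self_eq_norm_sq_to_K]
  norm_cast

lemma norm_sq_cfc {A : H →L[ℂ] H} (f : ℝ → ℝ)
    (hf : ContinuousOn f (spectrum ℝ A)) (v : H) :
    ‖cfc f A v‖ ^ 2 = (inner ℂ v (cfc (fun x => f x * f x) A v) : ℂ).re := by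
  rw [norm_sq_eq_re_inner (cfc_predicate f A), cfc_mul f f A]

lemma norm_cfc_apply_le {A : H →L[ℂ] H} {f g : ℝ → ℝ}
    (hf : ContinuousOn f (spectrum ℝ A)) (hg : ContinuousOn g (spectrum ℝ A))
    (h : ∀ x ∈ spectrum ℝ A, |f x| ≤ |g x|) (v : H) : ‖cfc f A v‖ ≤ ‖cfc g A v‖ := by
  refine (sq_le_sq₀ (norm_nonneg _) (norm_nonneg _)).1 ?_
  rw [norm_sq_cfc f hf, norm_sq_cfc g hg]
  have h0 : 0 ≤ (inner ℂ v (cfc (fun x => g x * g x - f x * f x) A v) : ℂ).re := by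
    refine re_inner_cfc_nonneg (fun x hx => ?_) v
    have := h x hx
    nlinarith [abs_mul_abs_self (f x), abs_mul_abs_self (g x), abs_nonneg (f x), abs_nonneg (g x)]
  rw [cfc_sub (fun x => g x * g x) (fun x => f x * f x) A (by fun_prop) (by fun_prop)] at h0
  simp only [ContinuousLinearMap.sub_apply, inner_sub_right, Complex.sub_re] at h0
  linarith

lemma sa_smul {X : H →L[ℂ] H} (hX : IsSelfAdjoint X) (r : ℝ) : IsSelfAdjoint (r • X) :=
  (IsSelfAdjoint.all r).smul hX

lemma sa_exp {X : H →L[ℂ] H} (hX : IsSelfAdjoint X) : IsSelfAdjoint (NormedSpace.exp X) := by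
  rw [← CFC.real_exp_eq_normedSpace_exp hX]; exact cfc_predicate _ _

lemma plog_exp {X : H →L[ℂ] H} (hX : IsSelfAdjoint X) : plog (NormedSpace.exp X) = X :=
  CFC.log_exp X hX

lemma exp_mul_exp_smul (X : H →L[ℂ] H) (r s : ℝ) :
    NormedSpace.exp (r • X) * NormedSpace.exp (s • X) = NormedSpace.exp ((r + s) • X) := by
  let _ : NormedAlgebra ℚ (H →L[ℂ] H) := NormedAlgebra.restrictScalars ℚ ℝ _
  rw [add_smul, NormedSpace.exp_add_of_commute]
  exact ((Commute.refl X).smul_left r).smul_right s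

lemma exp_mul_exp_neg (X : H →L[ℂ] H) :
    NormedSpace.exp X * NormedSpace.exp (-X) = 1 := by
  have := exp_mul_exp_smul X 1 (-1)
  simpa using this

lemma exp_neg_mul_exp (X : H →L[ℂ] H) :
    NormedSpace.exp (-X) * NormedSpace.exp X = 1 := by
  have := exp_mul_exp_smul X (-1) 1
  simpa using this

lemma isUnit_exp' (X : H →L[ℂ] H) : IsUnit (NormedSpace.exp X) :=
  ⟨⟨_, _, exp_mul_exp_neg X, exp_neg_mul_exp X⟩, rfl⟩

lemma psqrt_exp {X : H →L[ℂ] H} (hX : IsSelfAdjoint X) :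
    psqrt (NormedSpace.exp X) = NormedSpace.exp ((2:ℝ)⁻¹ • X) := by
  unfold psqrt
  rw [← CFC.real_exp_eq_normedSpace_exp hX, ← CFC.real_exp_eq_normedSpace_exp (sa_smul hX _),
    ← cfc_comp' Real.sqrt Real.exp X, ← cfc_comp_smul (2:ℝ)⁻¹ Real.exp X]
  refine cfc_congr fun x _ => ?_
  simp only [smul_eq_mul]
  rw [show (2:ℝ)⁻¹ * x = x / 2 by ring, Real.exp_half]

lemma pinvsqrt_exp {X : H →L[ℂ] H} (hX : IsSelfAdjoint X) :
    pinvsqrt (NormedSpace.exp X) = NormedSpace.exp ((-(2:ℝ)⁻¹) • X) := by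
  unfold pinvsqrt
  have hc : ContinuousOn (fun t : ℝ => (Real.sqrt t)⁻¹) (Real.exp '' spectrum ℝ X) := by
    refine ContinuousOn.inv₀ (by fun_prop) ?_
    rintro _ ⟨x, _, rfl⟩
    exact (Real.sqrt_pos.2 (Real.exp_pos x)).ne'
  rw [← CFC.real_exp_eq_normedSpace_exp hX, ← CFC.real_exp_eq_normedSpace_exp (sa_smul hX _),
    ← cfc_comp' (fun t : ℝ => (Real.sqrt t)⁻¹) Real.exp X hc, ← cfc_comp_smul (-(2:ℝ)⁻¹) Real.exp X]
  refine cfc_congr fun x _ => ?_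
  simp only [smul_eq_mul]
  rw [show -(2:ℝ)⁻¹ * x = -(x / 2) by ring, Real.exp_neg, Real.exp_half]

lemma spec_abs_le {X : H →L[ℂ] H} {x : ℝ} (hx : x ∈ spectrum ℝ X) : |x| ≤ ‖X‖ := by
  have : Nontrivial (H →L[ℂ] H) := by
    by_contra hn
    rw [not_nontrivial_iff_subsingleton] at hn
    simp at hx
  simpa using spectrum.norm_le_norm_of_mem hx

lemma abs_exp_sub_one_le (x : ℝ) : |Real.exp x - 1| ≤ Real.exp |x| * |x| := by
  rcases le_total 0 x with h | h
  · rw [abs_of_nonneg h, abs_of_nonneg (by linarith [Real.one_le_exp h])]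
    have := Real.add_one_le_exp (-x)
    have h2 : Real.exp x * Real.exp (-x) = 1 := by rw [← Real.exp_add]; simp
    nlinarith [Real.exp_pos x]
  · rw [abs_of_nonpos h, abs_of_nonpos (by linarith [Real.exp_le_one_iff.2 h])]
    have := Real.add_one_le_exp x
    have h3 : 1 ≤ Real.exp (-x) := Real.one_le_exp (by linarith)
    nlinarith

lemma norm_exp_sub_one_apply {X : H →L[ℂ] H} (hX : IsSelfAdjoint X) (v : H) :
    ‖(NormedSpace.exp X - 1) v‖ ≤ Real.exp ‖X‖ * ‖X v‖ := by
  have h1 : NormedSpace.exp X - 1 = cfc (fun x : ℝ => Real.exp x - 1) X := by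
    rw [cfc_sub Real.exp (fun _ => 1) X, cfc_const_one ℝ X, CFC.real_exp_eq_normedSpace_exp hX]
  have h2 : (Real.exp ‖X‖) • X = cfc (fun x : ℝ => Real.exp ‖X‖ * x) X := by
    rw [cfc_const_mul_id (Real.exp ‖X‖) X]
  have h3 : ‖((Real.exp ‖X‖) • X) v‖ = Real.exp ‖X‖ * ‖X v‖ := by
    simp [norm_smul]
  rw [← h3, h1, h2]
  refine norm_cfc_apply_le (by fun_prop) (by fun_prop) (fun x hx => ?_) v
  refine (abs_exp_sub_one_le x).trans ?_
  rw [abs_mul, Real.abs_exp]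
  gcongr
  exact spec_abs_le hx

lemma memP_exp {e : HilbertBasis ι ℂ H} {X : H →L[ℂ] H} (hX : MemS2 e X) :
    MemP e (NormedSpace.exp X) := by
  refine ⟨sa_exp hX.1, isUnit_exp' X, fun x => ?_, ?_⟩
  · have h1 : 0 ≤ NormedSpace.exp X := hX.1.exp_nonneg
    rw [ContinuousLinearMap.nonneg_iff_isPositive] at h1
    exact (Complex.le_def.1 (h1.inner_nonneg_left x)).1
  · exact isHS_of_le _ (norm_exp_sub_one_apply hX.1) hX.2

lemma MemP.nonneg {e : HilbertBasis ι ℂ H} {A : H →L[ℂ] H} (hA : MemP e A) : 0 ≤ A := by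
  rw [ContinuousLinearMap.nonneg_iff_isPositive, ContinuousLinearMap.isPositive_def']
  exact ⟨hA.1, hA.2.2.1⟩

lemma MemP.exp_plog {e : HilbertBasis ι ℂ H} {A : H →L[ℂ] H} (hA : MemP e A) :
    NormedSpace.exp (plog A) = A :=
  CFC.exp_log A (hA.2.1.isStrictlyPositive hA.nonneg)

lemma spec_lower {A A' : H →L[ℂ] H} (h1 : A * A' = 1) (h2 : A' * A = 1) {t : ℝ} (h0 : 0 ≤ A)
    (ht : t ∈ spectrum ℝ A) : 0 < t ∧ t⁻¹ ≤ ‖A'‖ := by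
  have h3 : 0 ≤ t := spectrum_nonneg_of_nonneg h0 ht
  have h4 : t ≠ 0 := by
    rintro rfl
    exact spectrum.zero_notMem ℝ (a := A) ⟨⟨A, A', h1, h2⟩, rfl⟩ ht
  let u : (H →L[ℂ] H)ˣ := ⟨A, A', h1, h2⟩
  have h6 : t⁻¹ ∈ spectrum ℝ A' := spectrum.inv₀_mem_inv_iff (a := u) |>.2 ht
  exact ⟨lt_of_le_of_ne h3 h4.symm, (le_abs_self _).trans (spec_abs_le h6)⟩

lemma MemP.plog {e : HilbertBasis ι ℂ H} {A : H →L[ℂ] H} (hA : MemP e A) :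
    MemS2 e (plog A) := by
  refine ⟨cfc_predicate _ _, ?_⟩
  obtain ⟨u, hu⟩ := hA.2.1
  have h1 : A * (↑u⁻¹ : H →L[ℂ] H) = 1 := by rw [← hu]; simp
  have h2 : (↑u⁻¹ : H →L[ℂ] H) * A = 1 := by rw [← hu]; simp
  set R := ‖(↑u⁻¹ : H →L[ℂ] H)‖ + 1 with hR
  have hR1 : 1 ≤ R := by have := norm_nonneg (↑u⁻¹ : H →L[ℂ] H); linarith
  have hsp : ∀ t ∈ spectrum ℝ A, 0 < t ∧ t⁻¹ ≤ R := fun t ht => by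
    have := spec_lower h1 h2 hA.nonneg ht
    exact ⟨this.1, by linarith [this.2]⟩
  refine isHS_of_le R (fun v => ?_) hA.2.2.2
  have h3 : A - 1 = cfc (fun x : ℝ => x - 1) A := by
    rw [cfc_sub (fun x : ℝ => x) (fun _ => 1) A, cfc_const_one ℝ A hA.1, cfc_id' ℝ A hA.1]
  have h4 : R * ‖(A - 1) v‖ = ‖cfc (fun x : ℝ => R * (x - 1)) A v‖ := by
    rw [cfc_const_mul R (fun x : ℝ => x - 1) A, ← h3]
    simp [norm_smul, abs_of_nonneg (zero_le_one.trans hR1)]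
  rw [h4]
  refine norm_cfc_apply_le (Real.continuousOn_log.mono fun t ht => (hsp t ht).1.ne') (by fun_prop)
    (fun t ht => ?_) v
  obtain ⟨ht0, ht1⟩ := hsp t ht
  rw [abs_mul, abs_of_nonneg (zero_le_one.trans hR1)]
  have hl1 := Real.log_le_sub_one_of_pos ht0
  have hl2 := Real.one_sub_inv_le_log_of_pos ht0
  rcases le_total 1 t with h | h
  · rw [abs_of_nonneg (Real.log_nonneg h), abs_of_nonneg (by linarith)]
    nlinarith
  · rw [abs_of_nonpos (Real.log_nonpos ht0.le h), abs_of_nonpos (by linarith)]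
    have : t⁻¹ - 1 = t⁻¹ * (1 - t) := by field_simp
    nlinarith

/-! ### The one-step estimate -/

lemma exp_apply_eigen {X : H →L[ℂ] H} (hX : IsSelfAdjoint X) {u : H} {x : ℝ}
    (hu : X u = (x : ℂ) • u) : NormedSpace.exp X u = ((Real.exp x : ℝ) : ℂ) • u := by
  have h1 : NormedSpace.exp X - algebraMap ℝ _ (Real.exp x)
      = cfc (fun t : ℝ => Real.exp t - Real.exp x) X := by
    rw [cfc_sub Real.exp (fun _ => Real.exp x) X, cfc_const (Real.exp x) X hX,
      CFC.real_exp_eq_normedSpace_exp hX]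
  set c := Real.exp x * Real.exp (‖X‖ + |x|) with hc
  have h2 : c • (X - algebraMap ℝ _ x) = cfc (fun t : ℝ => c * (t - x)) X := by
    rw [cfc_const_mul c (fun t : ℝ => t - x) X, cfc_sub (fun t : ℝ => t) (fun _ => x) X,
      cfc_const x X hX, cfc_id' ℝ X hX]
  have h3 : ‖(NormedSpace.exp X - algebraMap ℝ (H →L[ℂ] H) (Real.exp x)) u‖
      ≤ ‖(c • (X - algebraMap ℝ (H →L[ℂ] H) x)) u‖ := by
    rw [h1, h2]
    refine norm_cfc_apply_le (by fun_prop) (by fun_prop) (fun t ht => ?_) u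
    have h4 : Real.exp t - Real.exp x = Real.exp x * (Real.exp (t - x) - 1) := by
      rw [mul_sub, ← Real.exp_add]; ring_nf
    rw [h4, hc, abs_mul, abs_mul, abs_mul, Real.abs_exp, Real.abs_exp, mul_assoc]
    gcongr
    refine (abs_exp_sub_one_le _).trans ?_
    gcongr
    exact (abs_sub t x).trans (by gcongr; exact spec_abs_le ht)
  have h5 : (c • (X - algebraMap ℝ (H →L[ℂ] H) x)) u = 0 := by
    simp [Algebra.algebraMap_eq_smul_one, hu]
  rw [h5, norm_zero] at h3
  have h6 := norm_le_zero_iff.1 h3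
  simp only [Algebra.algebraMap_eq_smul_one, ContinuousLinearMap.sub_apply,
    ContinuousLinearMap.smul_apply, ContinuousLinearMap.one_apply, sub_eq_zero] at h6
  rw [h6, Complex.coe_smul]

lemma scalar_klein {R a t : ℝ} (hR : 1 ≤ R) (ha0 : 0 < a) (ha : a ≤ R) (ha' : a⁻¹ ≤ R)
    (ht0 : 0 < t) (ht' : t⁻¹ ≤ R) :
    0 ≤ Real.log t * Real.log t - Real.log a ^ 2 - 2 * (Real.log a * a⁻¹) * (t - a)
      + 2 * R ^ 3 * ((t - a) * (t - a)) := by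
  set L := Real.log (t / a) with hL
  have hlog : Real.log t = Real.log a + L := by
    rw [hL, Real.log_div ht0.ne' ha0.ne']; ring
  have hs : 0 < t / a := by positivity
  have h1 := Real.log_le_sub_one_of_pos hs
  have h2 := Real.one_sub_inv_le_log_of_pos hs
  rw [← hL] at h1 h2
  have e1 : t / a - 1 = a⁻¹ * (t - a) := by field_simp
  set D := a⁻¹ * (t - a) - L with hD
  have hD0 : 0 ≤ D := by linarith
  have hD1 : D ≤ a⁻¹ * t⁻¹ * (t - a) ^ 2 := by
    have : a⁻¹ * (t - a) - (1 - (t / a)⁻¹) = a⁻¹ * t⁻¹ * (t - a) ^ 2 := by field_simp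
    linarith
  have hD2 : D ≤ R ^ 2 * (t - a) ^ 2 := by
    refine hD1.trans ?_
    rw [pow_two R]
    gcongr
  have hla : |Real.log a| ≤ R := by
    rw [abs_le]
    have h3 := Real.log_le_sub_one_of_pos ha0
    have h4 := Real.one_sub_inv_le_log_of_pos ha0
    constructor <;> linarith
  have key : Real.log a * D ≤ R ^ 3 * (t - a) ^ 2 := by
    calc Real.log a * D ≤ R * (R ^ 2 * (t - a) ^ 2) := by
          have := le_abs_self (Real.log a)
          gcongr
          linarith
      _ = _ := by ring
  rw [hlog]
  have : (Real.log a + L) * (Real.log a + L) - Real.log a ^ 2 - 2 * (Real.log a * a⁻¹) * (t - a)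
      = L ^ 2 - 2 * (Real.log a * D) := by rw [hD]; ring
  rw [this]
  nlinarith [sq_nonneg L]

lemma klein_vec {Y : H →L[ℂ] H} (hY : IsSelfAdjoint Y) {R a : ℝ} (hR : 1 ≤ R) (ha0 : 0 < a)
    (ha : a ≤ R) (ha' : a⁻¹ ≤ R) (hYR : ‖NormedSpace.exp (-Y)‖ ≤ R) {u : H} (hu : ‖u‖ = 1) :
    Real.log a ^ 2 + 2 * (Real.log a * a⁻¹) *
        (inner ℂ u ((NormedSpace.exp Y - algebraMap ℝ _ a) u) : ℂ).re
      - 2 * R ^ 3 * ‖(NormedSpace.exp Y - algebraMap ℝ _ a) u‖ ^ 2 ≤ ‖Y u‖ ^ 2 := by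
  set B := NormedSpace.exp Y with hB
  have hBsa : IsSelfAdjoint B := sa_exp hY
  have hsp : ∀ t ∈ spectrum ℝ B, 0 < t ∧ t⁻¹ ≤ R := fun t ht => by
    have := spec_lower (exp_mul_exp_neg Y) (exp_neg_mul_exp Y) hY.exp_nonneg ht
    exact ⟨this.1, this.2.trans hYR⟩
  have hlogc : ContinuousOn Real.log (spectrum ℝ B) :=
    Real.continuousOn_log.mono fun t ht => (hsp t ht).1.ne'
  have hYl : Y = cfc Real.log B := (plog_exp hY).symm
  have hBa : B - algebraMap ℝ _ a = cfc (fun t : ℝ => t - a) B := by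
    rw [cfc_sub (fun t : ℝ => t) (fun _ => a) B, cfc_const a B hBsa, cfc_id' ℝ B hBsa]
  have h0 := re_inner_cfc_nonneg (A := B) (h := fun t => Real.log t * Real.log t - Real.log a ^ 2
    - 2 * (Real.log a * a⁻¹) * (t - a) + 2 * R ^ 3 * ((t - a) * (t - a)))
    (fun t ht => scalar_klein hR ha0 ha ha' (hsp t ht).1 (hsp t ht).2) u
  rw [cfc_add B (fun t => Real.log t * Real.log t - Real.log a ^ 2
    - 2 * (Real.log a * a⁻¹) * (t - a)) (fun t => 2 * R ^ 3 * ((t - a) * (t - a)))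
      (by fun_prop) (by fun_prop),
    cfc_sub (fun t => Real.log t * Real.log t - Real.log a ^ 2)
      (fun t => 2 * (Real.log a * a⁻¹) * (t - a)) B (by fun_prop) (by fun_prop),
    cfc_sub (fun t => Real.log t * Real.log t) (fun _ => Real.log a ^ 2) B
      (by fun_prop) (by fun_prop),
    cfc_const_mul (2 * R ^ 3) (fun t => (t - a) * (t - a)) B (by fun_prop),
    cfc_const_mul (2 * (Real.log a * a⁻¹)) (fun t => t - a) B (by fun_prop),
    cfc_const (Real.log a ^ 2) B hBsa] at h0
  simp only [ContinuousLinearMap.add_apply, ContinuousLinearMap.sub_apply,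
    ContinuousLinearMap.smul_apply, inner_add_right, inner_sub_right, Complex.add_re,
    Complex.sub_re, inner_smul_right_eq_smul, Complex.smul_re, smul_eq_mul] at h0
  rw [← norm_sq_cfc Real.log hlogc, ← norm_sq_cfc (fun t => t - a) (by fun_prop), ← hYl,
    ← hBa] at h0
  have h1 : (inner ℂ u ((algebraMap ℝ (H →L[ℂ] H) (Real.log a ^ 2)) u) : ℂ).re
      = Real.log a ^ 2 := by
    rw [Algebra.algebraMap_eq_smul_one, ContinuousLinearMap.smul_apply,
      ContinuousLinearMap.one_apply, inner_smul_right_eq_smul, Complex.smul_re,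
      inner_self_eq_norm_sq_to_K, hu]
    simp
  rw [h1] at h0
  linarith

lemma step_vec {X Y k : H →L[ℂ] H} (hX : IsSelfAdjoint X) (hY : IsSelfAdjoint Y)
    (hk : IsSelfAdjoint k) {R : ℝ} (hR : 1 ≤ R) (h1 : ‖NormedSpace.exp X‖ ≤ R)
    (h2 : ‖NormedSpace.exp (-X)‖ ≤ R) (h3 : ‖NormedSpace.exp (-Y)‖ ≤ R) (h4 : ‖k‖ ≤ R)
    (hB : NormedSpace.exp Y = (1 - k) * NormedSpace.exp X * (1 - k)) {u : H} (hu : ‖u‖ = 1)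
    {x : ℝ} (hx : X u = (x : ℂ) • u) :
    ‖X u‖ ^ 2 ≤ ‖Y u‖ ^ 2 + 4 * (‖X u‖ * ‖k u‖) + 20 * R ^ 7 * ‖k u‖ ^ 2 := by
  set a := Real.exp x with ha
  set A := NormedSpace.exp X with hA
  have hAu : A u = (a : ℂ) • u := exp_apply_eigen hX hx
  have hAu' : NormedSpace.exp (-X) u = ((Real.exp (-x) : ℝ) : ℂ) • u :=
    exp_apply_eigen hX.neg (by simp [hx])
  have ha0 : 0 < a := Real.exp_pos x
  have haR : a ≤ R := by
    have := A.le_opNorm u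
    rw [hAu, norm_smul, hu] at this
    simp [abs_of_pos ha0] at this
    exact this.trans h1
  have haR' : a⁻¹ ≤ R := by
    have := (NormedSpace.exp (-X)).le_opNorm u
    rw [hAu', norm_smul, hu] at this
    simp only [Complex.norm_real, Real.norm_eq_abs, Real.abs_exp, mul_one] at this
    rw [ha, ← Real.exp_neg]
    exact this.trans h2
  have hlog : Real.log a = x := Real.log_exp x
  have hXu : ‖X u‖ = |x| := by rw [hx, norm_smul, hu]; simp
  have hxR : |x| ≤ R := by
    rw [← hlog, abs_le]
    have h3 := Real.log_le_sub_one_of_pos ha0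
    have h4 := Real.one_sub_inv_le_log_of_pos ha0
    constructor <;> linarith
  have K := klein_vec hY hR ha0 haR haR' h3 hu
  rw [hlog] at K
  set w := k u with hw
  have hBu : (NormedSpace.exp Y - algebraMap ℝ (H →L[ℂ] H) a) u
      = - ((a : ℂ) • w) - A w + k (A w) := by
    rw [hB]
    simp only [Algebra.algebraMap_eq_smul_one, ContinuousLinearMap.sub_apply,
      ContinuousLinearMap.smul_apply, ContinuousLinearMap.one_apply, ContinuousLinearMap.mul_apply,
      map_sub, hAu, map_smul]
    rw [← hw, ← Complex.coe_smul, smul_sub]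
    abel
  have hAsa : IsSelfAdjoint A := sa_exp hX
  have i1 : (inner ℂ u (A w) : ℂ) = a * inner ℂ u w := by
    rw [← ContinuousLinearMap.adjoint_inner_left, ← ContinuousLinearMap.star_eq_adjoint,
      hAsa.star_eq, hAu, inner_smul_left]; simp
  have i2 : (inner ℂ u (k (A w)) : ℂ) = inner ℂ w (A w) := by
    rw [← ContinuousLinearMap.adjoint_inner_left, ← ContinuousLinearMap.star_eq_adjoint,
      hk.star_eq]
  have hin : (inner ℂ u ((NormedSpace.exp Y - algebraMap ℝ (H →L[ℂ] H) a) u) : ℂ).re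
      = - 2 * a * (inner ℂ u w : ℂ).re + (inner ℂ w (A w) : ℂ).re := by
    rw [hBu, inner_add_right, inner_sub_right, inner_neg_right, inner_smul_right, i1, i2]
    simp only [Complex.add_re, Complex.sub_re, Complex.neg_re, Complex.re_ofReal_mul]
    ring
  have hAw : ‖A w‖ ≤ R * ‖w‖ := (A.le_opNorm w).trans (by gcongr)
  have hn : ‖(NormedSpace.exp Y - algebraMap ℝ (H →L[ℂ] H) a) u‖ ≤ 3 * R ^ 2 * ‖w‖ := by
    rw [hBu]
    have t1 : ‖(a : ℂ) • w‖ ≤ R * ‖w‖ := by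
      rw [norm_smul]; simp only [Complex.norm_real, Real.norm_eq_abs, abs_of_pos ha0]; gcongr
    have t2 : ‖k (A w)‖ ≤ R * (R * ‖w‖) := (k.le_opNorm _).trans (by gcongr)
    have t3 := norm_add_le (- ((a : ℂ) • w) - A w) (k (A w))
    have t4 := norm_sub_le (- ((a : ℂ) • w)) (A w)
    rw [norm_neg] at t4
    have t5 : R * ‖w‖ ≤ R ^ 2 * ‖w‖ := by
      have := norm_nonneg w
      gcongr; nlinarith
    nlinarith
  have hn2 : ‖(NormedSpace.exp Y - algebraMap ℝ (H →L[ℂ] H) a) u‖ ^ 2 ≤ 9 * R ^ 4 * ‖w‖ ^ 2 := by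
    calc _ ≤ (3 * R ^ 2 * ‖w‖) ^ 2 := pow_le_pow_left₀ (norm_nonneg _) hn 2
      _ = _ := by ring
  have j1 : |(inner ℂ u w : ℂ).re| ≤ ‖w‖ := by
    refine (Complex.abs_re_le_norm _).trans ((norm_inner_le_norm _ _).trans ?_)
    rw [hu, one_mul]
  have j2 : |(inner ℂ w (A w) : ℂ).re| ≤ R * ‖w‖ ^ 2 := by
    refine (Complex.abs_re_le_norm _).trans ((norm_inner_le_norm _ _).trans ?_)
    nlinarith [norm_nonneg w]
  rw [hin] at K
  have e1 : 2 * (x * a⁻¹) * (- 2 * a * (inner ℂ u w : ℂ).re + (inner ℂ w (A w) : ℂ).re)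
     = - 4 * (x * (inner ℂ u w : ℂ).re) + 2 * (x * a⁻¹ * (inner ℂ w (A w) : ℂ).re) := by
    field_simp
    ring
  rw [e1] at K
  have b1 : x * (inner ℂ u w : ℂ).re ≤ |x| * ‖w‖ := by
    refine (le_abs_self _).trans ?_
    rw [abs_mul]; gcongr
  have b2 : - (R ^ 3 * ‖w‖ ^ 2) ≤ x * a⁻¹ * (inner ℂ w (A w) : ℂ).re := by
    refine neg_le_of_abs_le ?_
    rw [abs_mul, abs_mul, abs_of_pos (inv_pos.2 ha0)]
    calc |x| * a⁻¹ * |(inner ℂ w (A w) : ℂ).re| ≤ R * R * (R * ‖w‖ ^ 2) := by gcongr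
      _ = _ := by ring
  have b3 : 2 * R ^ 3 * ‖(NormedSpace.exp Y - algebraMap ℝ (H →L[ℂ] H) a) u‖ ^ 2
      ≤ 18 * R ^ 7 * ‖w‖ ^ 2 := by
    calc _ ≤ 2 * R ^ 3 * (9 * R ^ 4 * ‖w‖ ^ 2) := by gcongr
      _ = _ := by ring
  have b4 : R ^ 3 * ‖w‖ ^ 2 ≤ R ^ 7 * ‖w‖ ^ 2 := by
    gcongr
    norm_num
  rw [hXu, sq_abs]
  linarith

lemma step_hs {e : HilbertBasis ι ℂ H} {X Y k : H →L[ℂ] H} (hX : MemS2 e X) (hY : MemS2 e Y)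
    (hk : MemS2 e k) {R : ℝ} (hR : 1 ≤ R) (h1 : ‖NormedSpace.exp X‖ ≤ R)
    (h2 : ‖NormedSpace.exp (-X)‖ ≤ R) (h3 : ‖NormedSpace.exp (-Y)‖ ≤ R) (h4 : ‖k‖ ≤ R)
    (hB : NormedSpace.exp Y = (1 - k) * NormedSpace.exp X * (1 - k)) :
    hsNorm e X ^ 2 ≤ hsNorm e Y ^ 2 + 4 * (hsNorm e X * hsNorm e k)
      + 20 * R ^ 7 * hsNorm e k ^ 2 := by
  obtain ⟨w, f, x, hf⟩ := exists_eigenbasis hX.1 hX.2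
  rw [hsNorm_basis e f X, hsNorm_basis e f Y, hsNorm_basis e f k]
  have sX := isHS_basis e f hX.2
  have sY := isHS_basis e f hY.2
  have sk := isHS_basis e f hk.2
  have sXk : Summable fun i => ‖X (f i)‖ * ‖k (f i)‖ := by
    refine Summable.of_nonneg_of_le (fun _ => by positivity) (fun i => ?_) (Summable.add sX sk)
    nlinarith [sq_nonneg (‖X (f i)‖ - ‖k (f i)‖), sq_nonneg (‖X (f i)‖), sq_nonneg (‖k (f i)‖)]
  have hCS : ∑' i, ‖X (f i)‖ * ‖k (f i)‖ ≤ hsNorm f X * hsNorm f k := by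
    refine Real.tsum_le_of_sum_le (fun _ => by positivity) fun s => ?_
    refine (abs_le_of_sq_le_sq' ?_ (mul_nonneg (hsNorm_nonneg _ _) (hsNorm_nonneg _ _))).2
    refine (Finset.sum_mul_sq_le_sq_mul_sq s _ _).trans ?_
    rw [mul_pow, hsNorm_sq, hsNorm_sq]
    gcongr
    · exact sX.sum_le_tsum _ (fun _ _ => by positivity)
    · exact sk.sum_le_tsum _ (fun _ _ => by positivity)
  have hsum := hasSum_le (fun i => step_vec hX.1 hY.1 hk.1 hR h1 h2 h3 h4 hB
    (f.orthonormal.1 i) (hf i)) sX.hasSum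
    ((sY.hasSum.add (sXk.hasSum.mul_left 4)).add (sk.hasSum.mul_left (20 * R ^ 7)))
  rw [← hsNorm_sq, ← hsNorm_sq, ← hsNorm_sq] at hsum
  linarith


/-! ### Triangle inequality -/

lemma memP_conj {e : HilbertBasis ι ℂ H} {g A : H →L[ℂ] H} (hg : IsUnit g)
    (hh : IsHS e (g * star g - 1)) (hA : MemP e A) : MemP e (g * A * star g) := by
  refine ⟨hA.1.conjugate g, (hg.mul hA.2.1).mul hg.star, fun x => ?_, ?_⟩
  · have := hA.2.2.1 (star g x)
    rw [ContinuousLinearMap.star_eq_adjoint, ContinuousLinearMap.adjoint_inner_right] at this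
    simpa [ContinuousLinearMap.star_eq_adjoint] using this
  · have h1 : g * A * star g - 1 = g * ((A - 1) * star g) + (g * star g - 1) := by
      noncomm_ring
    rw [h1]
    exact ((hA.2.2.2.mul_right' _).mul_left' _).add' hh

lemma exp_neg_plog {e : HilbertBasis ι ℂ H} {A B : H →L[ℂ] H} (hA : MemP e A) (h : A * B = 1) :
    NormedSpace.exp (-plog A) = B := by
  refine left_inv_eq_right_inv (a := A) ?_ h
  conv_lhs => rw [← hA.exp_plog]
  rw [plog_exp hA.plog.1]
  exact exp_neg_mul_exp _

lemma norm_exp_le_of_sa {X : H →L[ℂ] H} (hX : IsSelfAdjoint X) :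
    ‖NormedSpace.exp X‖ ≤ Real.exp ‖X‖ := by
  rw [← CFC.real_exp_eq_normedSpace_exp hX]
  refine norm_cfc_le (Real.exp_pos _).le fun x hx => ?_
  rw [Real.norm_eq_abs, abs_of_pos (Real.exp_pos _)]
  exact Real.exp_le_exp.2 ((le_abs_self x).trans (spec_abs_le hx))

lemma MemS2.smul {e : HilbertBasis ι ℂ H} {X : H →L[ℂ] H} (hX : MemS2 e X) (r : ℝ) :
    MemS2 e (r • X) := ⟨sa_smul hX.1 r, hX.2.smul' r⟩

lemma MemS2.neg {e : HilbertBasis ι ℂ H} {X : H →L[ℂ] H} (hX : MemS2 e X) :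
    MemS2 e (-X) := by simpa using hX.smul (-1)

lemma memP_exp_conj {e : HilbertBasis ι ℂ H} {A Z : H →L[ℂ] H} (hZ : MemS2 e Z) (hA : MemP e A) :
    MemP e (NormedSpace.exp Z * A * NormedSpace.exp Z) := by
  have h1 : star (NormedSpace.exp Z) = NormedSpace.exp Z := (sa_exp hZ.1).star_eq
  have := memP_conj (e := e) (g := NormedSpace.exp Z) (isUnit_exp' Z) ?_ hA
  · rwa [h1] at this
  · rw [h1]
    have h2 := exp_mul_exp_smul Z 1 1
    rw [one_smul] at h2
    rw [h2]
    exact (memP_exp (hZ.smul _)).2.2.2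

lemma scalar_step {N N' κ C δ : ℝ} (hN : 0 ≤ N) (hκ : 0 ≤ κ) (hC : 0 ≤ C) (hδ : 0 < δ)
    (h : N' ^ 2 ≤ N ^ 2 + 4 * (N' * κ) + C * κ ^ 2) :
    max N' δ ≤ max N δ + (2 * κ + (C + 4) * κ ^ 2 / δ) := by
  have hM1 := le_max_left N δ
  have hM2 := le_max_right N δ
  set M := max N δ
  set c := (C + 4) * κ ^ 2 / δ with hc
  have hc0 : 0 ≤ c := by positivity
  have hcδ : c * δ = (C + 4) * κ ^ 2 := by rw [hc]; field_simp
  refine max_le ?_ (by linarith)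
  by_contra hcon
  push Not at hcon
  have h1 : M + c < N' - 2 * κ := by linarith
  have h2 : (M + c) ^ 2 < (N' - 2 * κ) ^ 2 := by
    apply pow_lt_pow_left₀ h1 (by linarith) (by norm_num)
  have h3 : δ * c ≤ M * c := by gcongr
  have h4 : N ^ 2 ≤ M ^ 2 := by gcongr
  nlinarith

lemma step_line {e : HilbertBasis ι ℂ H} {X Z : H →L[ℂ] H} (hX : MemS2 e X) (hZ : MemS2 e Z) :
    ∃ C : ℝ, 0 ≤ C ∧ ∀ s h : ℝ, 0 ≤ s → 0 ≤ h → s + h ≤ 1 →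
      hsNorm e (plog (NormedSpace.exp ((s + h) • Z) * NormedSpace.exp X *
        NormedSpace.exp ((s + h) • Z))) ^ 2 ≤
      hsNorm e (plog (NormedSpace.exp (s • Z) * NormedSpace.exp X * NormedSpace.exp (s • Z))) ^ 2
      + 4 * (hsNorm e (plog (NormedSpace.exp ((s + h) • Z) * NormedSpace.exp X *
        NormedSpace.exp ((s + h) • Z))) * (Real.exp (h * ‖Z‖) * (h * hsNorm e Z)))
      + C * (Real.exp (h * ‖Z‖) * (h * hsNorm e Z)) ^ 2 := by
  set E := Real.exp ‖Z‖ with hE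
  have hE1 : 1 ≤ E := Real.one_le_exp (norm_nonneg _)
  set R := E * (‖NormedSpace.exp X‖ + ‖NormedSpace.exp (-X)‖) * E + 2 + E with hR
  have hR1 : 1 ≤ R := by
    have : 0 ≤ E * (‖NormedSpace.exp X‖ + ‖NormedSpace.exp (-X)‖) * E := by positivity
    linarith
  have hnb : ∀ s : ℝ, |s| ≤ 1 → ‖NormedSpace.exp (s • Z)‖ ≤ E := by
    intro s hs
    refine (norm_exp_le_of_sa (sa_smul hZ.1 s)).trans (Real.exp_le_exp.2 ?_)
    rw [norm_smul, Real.norm_eq_abs]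
    nlinarith [norm_nonneg Z]
  set A : ℝ → (H →L[ℂ] H) := fun s =>
    NormedSpace.exp (s • Z) * NormedSpace.exp X * NormedSpace.exp (s • Z) with hA
  have hAP : ∀ s, MemP e (A s) := fun s => memP_exp_conj (hZ.smul s) (memP_exp hX)
  have hAn : ∀ s : ℝ, |s| ≤ 1 → ‖A s‖ ≤ R := by
    intro s hs
    have h1 : ‖A s‖ ≤ E * ‖NormedSpace.exp X‖ * E := by
      refine (norm_mul_le _ _).trans ?_
      have := norm_mul_le (NormedSpace.exp (s • Z)) (NormedSpace.exp X)
      have h2 := hnb s hs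
      calc _ ≤ (‖NormedSpace.exp (s • Z)‖ * ‖NormedSpace.exp X‖) * ‖NormedSpace.exp (s • Z)‖ := by
            gcongr
        _ ≤ _ := by gcongr
    have h3 : E * ‖NormedSpace.exp X‖ * E ≤
        E * (‖NormedSpace.exp X‖ + ‖NormedSpace.exp (-X)‖) * E := by
      gcongr; linarith [norm_nonneg (NormedSpace.exp (-X))]
    linarith
  have hAi : ∀ s : ℝ, |s| ≤ 1 → ‖NormedSpace.exp (-plog (A s))‖ ≤ R := by
    intro s hs
    have h0 : NormedSpace.exp (-plog (A s)) =
        NormedSpace.exp ((-s) • Z) * NormedSpace.exp (-X) * NormedSpace.exp ((-s) • Z) := by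
      refine exp_neg_plog (hAP s) ?_
      have h1 : NormedSpace.exp (s • Z) * NormedSpace.exp ((-s) • Z) = 1 := by
        rw [exp_mul_exp_smul]; simp
      have h2 := exp_mul_exp_neg X
      calc _ = NormedSpace.exp (s • Z) * (NormedSpace.exp X *
            (NormedSpace.exp (s • Z) * NormedSpace.exp ((-s) • Z)) * NormedSpace.exp (-X)) *
            NormedSpace.exp ((-s) • Z) := by simp only [hA]; noncomm_ring
        _ = 1 := by rw [h1, mul_one, h2, mul_one, h1]
    rw [h0]
    have h1 : ‖NormedSpace.exp ((-s) • Z) * NormedSpace.exp (-X) * NormedSpace.exp ((-s) • Z)‖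
        ≤ E * ‖NormedSpace.exp (-X)‖ * E := by
      refine (norm_mul_le _ _).trans ?_
      have := norm_mul_le (NormedSpace.exp ((-s) • Z)) (NormedSpace.exp (-X))
      have h2 := hnb (-s) (by rwa [abs_neg])
      calc _ ≤ (‖NormedSpace.exp ((-s) • Z)‖ * ‖NormedSpace.exp (-X)‖) *
            ‖NormedSpace.exp ((-s) • Z)‖ := by gcongr
        _ ≤ _ := by gcongr
    have h3 : E * ‖NormedSpace.exp (-X)‖ * E ≤
        E * (‖NormedSpace.exp X‖ + ‖NormedSpace.exp (-X)‖) * E := by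
      gcongr; linarith [norm_nonneg (NormedSpace.exp X)]
    linarith
  refine ⟨20 * R ^ 7, by positivity, fun s h hs hh hsh => ?_⟩
  set k : H →L[ℂ] H := 1 - NormedSpace.exp ((-h) • Z) with hk
  have hkb : ∀ v, ‖k v‖ ≤ (Real.exp (h * ‖Z‖) * h) * ‖Z v‖ := by
    intro v
    have h1 := norm_exp_sub_one_apply (sa_smul hZ.1 (-h)) v
    have h2 : k v = -((NormedSpace.exp ((-h) • Z) - 1) v) := by simp [hk]
    rw [h2, norm_neg]
    refine h1.trans (le_of_eq ?_)
    rw [norm_smul, Real.norm_eq_abs, abs_neg, abs_of_nonneg hh, ContinuousLinearMap.smul_apply,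
      norm_smul, Real.norm_eq_abs, abs_neg, abs_of_nonneg hh]
    ring
  have hkS : MemS2 e k :=
    ⟨(IsSelfAdjoint.one _).sub (sa_exp (sa_smul hZ.1 _)), isHS_of_le _ hkb hZ.2⟩
  have hkN : hsNorm e k ≤ Real.exp (h * ‖Z‖) * (h * hsNorm e Z) := by
    have := hsNorm_le_of_le (e := e) (c := Real.exp (h * ‖Z‖) * h) (by positivity) hkb hZ.2
    linarith
  have hkn : ‖k‖ ≤ R := by
    have h1 := hnb (-h) (by rw [abs_neg, abs_of_nonneg hh]; linarith)
    have h2 : ‖k‖ ≤ 1 + E :=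
      (norm_sub_le _ _).trans (add_le_add ContinuousLinearMap.norm_id_le h1)
    have : 0 ≤ E * (‖NormedSpace.exp X‖ + ‖NormedSpace.exp (-X)‖) * E := by positivity
    linarith
  have hs1 : |s| ≤ 1 := by rw [abs_of_nonneg hs]; linarith
  have hs2 : |s + h| ≤ 1 := by rw [abs_of_nonneg (by linarith)]; linarith
  have key := step_hs (hAP (s + h)).plog (hAP s).plog hkS hR1
    (by rw [(hAP (s + h)).exp_plog]; exact hAn _ hs2) (hAi _ hs2) (hAi _ hs1) hkn (by
      rw [(hAP (s + h)).exp_plog, (hAP s).exp_plog]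
      have h1 : NormedSpace.exp ((-h) • Z) * NormedSpace.exp ((s + h) • Z)
          = NormedSpace.exp (s • Z) := by rw [exp_mul_exp_smul]; congr 2; ring
      have h2 : NormedSpace.exp ((s + h) • Z) * NormedSpace.exp ((-h) • Z)
          = NormedSpace.exp (s • Z) := by rw [exp_mul_exp_smul]; congr 2; ring
      have h3 : 1 - k = NormedSpace.exp ((-h) • Z) := by rw [hk]; abel
      rw [h3]
      simp only [hA]
      rw [← mul_assoc, ← mul_assoc, h1, mul_assoc (NormedSpace.exp (s • Z) * NormedSpace.exp X), h2])
  have hk0 := hsNorm_nonneg e k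
  have hN0 := hsNorm_nonneg e (plog (A (s + h)))
  refine key.trans ?_
  gcongr

lemma tri_exp {e : HilbertBasis ι ℂ H} {X Z : H →L[ℂ] H} (hX : MemS2 e X) (hZ : MemS2 e Z) :
    hsNorm e (plog (NormedSpace.exp Z * NormedSpace.exp X * NormedSpace.exp Z))
      ≤ hsNorm e X + 2 * hsNorm e Z := by
  obtain ⟨C, hC, hstep⟩ := step_line hX hZ
  set N : ℝ → ℝ := fun s => hsNorm e (plog (NormedSpace.exp (s • Z) * NormedSpace.exp X *
        NormedSpace.exp (s • Z))) with hN
  have hN0 : N 0 = hsNorm e X := by simp [hN, plog_exp hX.1]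
  have hN1 : N 1 = hsNorm e (plog (NormedSpace.exp Z * NormedSpace.exp X * NormedSpace.exp Z)) := by
    simp [hN]
  rw [← hN1, ← hN0]
  have hZ0 := hsNorm_nonneg e Z
  set κ : ℕ → ℝ := fun n => Real.exp (((n:ℝ) + 1)⁻¹ * ‖Z‖) * (((n:ℝ) + 1)⁻¹ * hsNorm e Z) with hκ
  have main : ∀ δ : ℝ, 0 < δ → ∀ n : ℕ,
      N 1 ≤ max (N 0) δ + ((n:ℝ) + 1) * (2 * κ n + (C + 4) * κ n ^ 2 / δ) := by
    intro δ hδ n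
    have hind : ∀ i : ℕ, i ≤ n + 1 → max (N (i * ((n:ℝ) + 1)⁻¹)) δ ≤
        max (N 0) δ + i * (2 * κ n + (C + 4) * κ n ^ 2 / δ) := by
      intro i
      induction i with
      | zero => intro _; simp
      | succ i ih =>
        intro hi
        have h1 := ih (by omega)
        have h2 : ((i:ℝ) + 1) ≤ n + 1 := by exact_mod_cast hi
        have h3 := hstep (i * ((n:ℝ) + 1)⁻¹) (((n:ℝ) + 1)⁻¹) (by positivity) (by positivity) (by
          rw [← add_one_mul, ← div_eq_mul_inv]
          exact (div_le_one (by positivity)).2 h2)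
        have h4 := scalar_step (hsNorm_nonneg e _) (by positivity) hC hδ h3
        have h5 : ((i:ℝ) * ((n:ℝ) + 1)⁻¹ + ((n:ℝ) + 1)⁻¹) = ((i + 1 : ℕ) : ℝ) * ((n:ℝ) + 1)⁻¹ := by
          push_cast; ring
        rw [h5] at h4
        calc _ ≤ max (N (i * ((n:ℝ) + 1)⁻¹)) δ + (2 * κ n + (C + 4) * κ n ^ 2 / δ) := h4
          _ ≤ _ := by push_cast; linarith
    have h1 := hind (n + 1) le_rfl
    have h2 : ((n + 1 : ℕ) : ℝ) * ((n:ℝ) + 1)⁻¹ = 1 := by push_cast; field_simp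
    rw [h2] at h1
    push_cast at h1
    exact (le_max_left _ _).trans h1
  have hlim : ∀ δ : ℝ, 0 < δ → N 1 ≤ max (N 0) δ + 2 * hsNorm e Z := by
    intro δ hδ
    have hinv : Tendsto (fun n : ℕ => ((n:ℝ) + 1)⁻¹) atTop (𝓝 0) := by
      simpa using tendsto_one_div_add_atTop_nhds_zero_nat (𝕜 := ℝ)
    have hcont : Tendsto (fun x : ℝ => max (N 0) δ + (2 * (Real.exp (x * ‖Z‖) * hsNorm e Z) +
        (C + 4) * (x * (Real.exp (x * ‖Z‖) * hsNorm e Z) ^ 2) / δ)) (𝓝 0)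
        (𝓝 (max (N 0) δ + 2 * hsNorm e Z)) := by
      have : Continuous (fun x : ℝ => max (N 0) δ + (2 * (Real.exp (x * ‖Z‖) * hsNorm e Z) +
        (C + 4) * (x * (Real.exp (x * ‖Z‖) * hsNorm e Z) ^ 2) / δ)) := by fun_prop
      simpa using this.tendsto 0
    refine ge_of_tendsto' (hcont.comp hinv) fun n => ?_
    refine (main δ hδ n).trans (le_of_eq ?_)
    simp only [Function.comp, hκ]
    field_simp
  refine le_of_forall_pos_le_add fun δ hδ => (hlim δ hδ).trans ?_
  have : max (N 0) δ ≤ N 0 + δ := max_le (by linarith) (by linarith [hsNorm_nonneg e (plog (NormedSpace.exp ((0:ℝ) • Z) * NormedSpace.exp X * NormedSpace.exp ((0:ℝ) • Z)))])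
  linarith

lemma exp_unitary_conj {u : H →L[ℂ] H} (hu : u ∈ unitary (H →L[ℂ] H)) (X : H →L[ℂ] H) :
    NormedSpace.exp (u * X * star u) = u * NormedSpace.exp X * star u := by
  let _ : NormedAlgebra ℚ (H →L[ℂ] H) := NormedAlgebra.restrictScalars ℚ ℝ _
  have h1 := Unitary.star_mul_self_of_mem hu
  have h2 := Unitary.mul_star_self_of_mem hu
  exact NormedSpace.exp_units_conj ⟨u, star u, h2, h1⟩ X

lemma norm_plog_unitary {e : HilbertBasis ι ℂ H} {u A : H →L[ℂ] H}
    (hu : u ∈ unitary (H →L[ℂ] H)) (hA : MemP e A) :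
    hsNorm e (plog (u * A * star u)) = hsNorm e (plog A) := by
  rw [← hsNorm_conj e hu (plog A)]
  congr 1
  conv_lhs => rw [← hA.exp_plog]
  rw [← exp_unitary_conj hu, plog_exp (hA.plog.1.conjugate u)]

lemma polar {e : HilbertBasis ι ℂ H} {g : H →L[ℂ] H} (hg : IsUnit g)
    (hP : MemP e (g * star g)) :
    ∃ v ∈ unitary (H →L[ℂ] H), g = NormedSpace.exp ((2:ℝ)⁻¹ • plog (g * star g)) * v := by
  set Z := (2:ℝ)⁻¹ • plog (g * star g) with hZ
  have hZs : IsSelfAdjoint Z := sa_smul hP.plog.1 _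
  have hs : star (NormedSpace.exp (-Z)) = NormedSpace.exp (-Z) := (sa_exp hZs.neg).star_eq
  have h2 : g * star g = NormedSpace.exp Z * NormedSpace.exp Z := by
    conv_lhs => rw [← hP.exp_plog]
    rw [hZ, exp_mul_exp_smul]; norm_num
  have h3 : NormedSpace.exp (-Z) * g * star (NormedSpace.exp (-Z) * g) = 1 := by
    rw [star_mul, hs]
    calc _ = NormedSpace.exp (-Z) * (g * star g) * NormedSpace.exp (-Z) := by noncomm_ring
      _ = (NormedSpace.exp (-Z) * NormedSpace.exp Z) * (NormedSpace.exp Z * NormedSpace.exp (-Z)) := by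
        rw [h2]; noncomm_ring
      _ = 1 := by rw [exp_neg_mul_exp, exp_mul_exp_neg, mul_one]
  refine ⟨NormedSpace.exp (-Z) * g, ?_, ?_⟩
  · have hu : IsUnit (NormedSpace.exp (-Z) * g) := (isUnit_exp' _).mul hg
    refine Unitary.mem_iff.2 ⟨?_, h3⟩
    obtain ⟨w, hw⟩ := hu
    rw [← hw] at h3 ⊢
    have : star (w : H →L[ℂ] H) = ↑w⁻¹ := by
      rw [← one_mul (star (w : H →L[ℂ] H)), ← Units.inv_mul w, mul_assoc, h3, mul_one]
    rw [this]; simp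
  · rw [← mul_assoc, exp_mul_exp_neg, one_mul]

/-- General triangle inequality. -/
lemma tri {e : HilbertBasis ι ℂ H} {g A : H →L[ℂ] H} (hg : IsUnit g)
    (hP : MemP e (g * star g)) (hA : MemP e A) :
    hsNorm e (plog (g * A * star g)) ≤ hsNorm e (plog A) + hsNorm e (plog (g * star g)) := by
  obtain ⟨v, hv, hgv⟩ := polar hg hP
  set Z := (2:ℝ)⁻¹ • plog (g * star g) with hZ
  have hZS : MemS2 e Z := hP.plog.smul _
  have hs : star (NormedSpace.exp Z) = NormedSpace.exp Z := (sa_exp hZS.1).star_eq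
  have hB : MemP e (v * A * star v) := by
    refine memP_conj ⟨⟨v, star v, Unitary.mul_star_self_of_mem hv,
      Unitary.star_mul_self_of_mem hv⟩, rfl⟩ ?_ hA
    rw [Unitary.mul_star_self_of_mem hv, sub_self]
    simp [IsHS]
  have h1 : g * A * star g = NormedSpace.exp Z * NormedSpace.exp (plog (v * A * star v)) *
      NormedSpace.exp Z := by
    rw [hB.exp_plog]
    conv_lhs => rw [hgv]
    rw [star_mul, hs]; noncomm_ring
  rw [h1]
  refine (tri_exp hB.plog hZS).trans ?_
  rw [norm_plog_unitary hv hA, hZ, hsNorm_smul']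
  norm_num
  linarith

/-! ### Doubling and the exponential metric increasing property -/

/-- `N (e^{-X/2} e^Y e^{-X/2})`. -/
def phi (e : HilbertBasis ι ℂ H) (X Y : H →L[ℂ] H) : ℝ :=
  hsNorm e (plog (NormedSpace.exp ((-(2:ℝ)⁻¹) • X) * NormedSpace.exp Y *
    NormedSpace.exp ((-(2:ℝ)⁻¹) • X)))

lemma isUnit_of_memP_mul_star_pow {T : H →L[ℂ] H} (hT : IsUnit T) (n : ℕ) : IsUnit (T ^ n) :=
  hT.pow n

lemma memP_one (e : HilbertBasis ι ℂ H) : MemP e (1 : H →L[ℂ] H) := by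
  have : MemP e (NormedSpace.exp (0 : H →L[ℂ] H)) :=
    memP_exp ⟨IsSelfAdjoint.zero _, by simp [IsHS]⟩
  simpa using this

lemma pow_bound {e : HilbertBasis ι ℂ H} {T : H →L[ℂ] H} (hT : IsUnit T)
    (hP : MemP e (T * star T)) (n : ℕ) :
    MemP e (T ^ n * star (T ^ n)) ∧
      hsNorm e (plog (T ^ n * star (T ^ n))) ≤ n * hsNorm e (plog (T * star T)) := by
  induction n with
  | zero =>
    refine ⟨by simpa using memP_one e, ?_⟩
    have : plog (1 : H →L[ℂ] H) = 0 := by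
      have := plog_exp (IsSelfAdjoint.zero (H →L[ℂ] H))
      simpa using this
    simp [this, hsNorm]
  | succ n ih =>
    have h1 : T ^ (n + 1) * star (T ^ (n + 1)) = T * (T ^ n * star (T ^ n)) * star T := by
      rw [pow_succ', star_mul]; noncomm_ring
    rw [h1]
    refine ⟨memP_conj hT hP.2.2.2 ih.1, (tri hT hP ih.1).trans ?_⟩
    push_cast
    linarith [ih.2]

lemma exp_pow_smul (L : H →L[ℂ] H) (n : ℕ) :
    NormedSpace.exp L ^ n = NormedSpace.exp ((n:ℝ) • L) := by
  induction n with
  | zero => simp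
  | succ n ih =>
    have := exp_mul_exp_smul L n 1
    rw [one_smul] at this
    rw [pow_succ, ih, this]; push_cast; rfl

lemma doubling {e : HilbertBasis ι ℂ H} {X Y : H →L[ℂ] H} (hX : MemS2 e X) (hY : MemS2 e Y) :
    2 * phi e X Y ≤ phi e ((2:ℝ) • X) ((2:ℝ) • Y) := by
  have hh : (-(2:ℝ)⁻¹) • ((2:ℝ) • X) = (-1:ℝ) • X := by rw [smul_smul]; norm_num
  unfold phi
  rw [hh]
  set b := NormedSpace.exp ((-(2:ℝ)⁻¹) • X) with hb
  set a := NormedSpace.exp ((2:ℝ)⁻¹ • X) with ha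
  set y := NormedSpace.exp Y with hy
  have hab : a * b = 1 := by rw [ha, hb, exp_mul_exp_smul]; simp
  have hba : b * a = 1 := by rw [ha, hb, exp_mul_exp_smul]; simp
  have hbb : b * b = NormedSpace.exp ((-1:ℝ) • X) := by
    rw [hb, exp_mul_exp_smul]; congr 2; norm_num
  have haa : a * a = NormedSpace.exp X := by
    rw [ha, exp_mul_exp_smul]; norm_num
  have hsa : star a = a := (sa_exp (sa_smul hX.1 _)).star_eq
  have hsb : star b = b := (sa_exp (sa_smul hX.1 _)).star_eq
  have hsy : star y = y := (sa_exp hY.1).star_eq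
  have hyy : y * y = NormedSpace.exp ((2:ℝ) • Y) := by
    have := exp_mul_exp_smul Y 1 1
    rw [one_smul] at this
    rw [hy, this]; norm_num
  set C := b * y * b with hC
  have hCP : MemP e C := memP_exp_conj (hX.smul _) (memP_exp hY)
  set T := b * b * y with hT
  have hTu : IsUnit T := ((isUnit_exp' _).mul (isUnit_exp' _)).mul (isUnit_exp' _)
  have hTT : T * star T = NormedSpace.exp ((-1:ℝ) • X) * NormedSpace.exp ((2:ℝ) • Y) *
      NormedSpace.exp ((-1:ℝ) • X) := by
    rw [hT, star_mul, star_mul, hsb, hsy, ← hbb, ← hyy]; noncomm_ring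
  have hTP : MemP e (T * star T) := by
    rw [hTT]; exact memP_exp_conj (hX.smul _) (memP_exp (hY.smul _))
  rw [← hTT]
  have hCn : ∀ n : ℕ, C ^ n = a * T ^ n * b := by
    intro n
    induction n with
    | zero => simp [hab]
    | succ n ih =>
      rw [pow_succ, ih, pow_succ, hC, hT]
      calc _ = a * (b * b * y) ^ n * (b * b) * y * b := by noncomm_ring
        _ = _ := by noncomm_ring
  have key : ∀ n : ℕ, (2 * n : ℝ) * hsNorm e (plog C) ≤
      2 * hsNorm e X + n * hsNorm e (plog (T * star T)) := by
    intro n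
    obtain ⟨hP1, hN1⟩ := pow_bound hTu hTP n
    have hXn : hsNorm e (plog (NormedSpace.exp ((-1:ℝ) • X))) = hsNorm e X := by
      rw [plog_exp (sa_smul hX.1 _), hsNorm_smul']; simp
    have h1 : C ^ n * star (C ^ n) = a * (T ^ n * NormedSpace.exp ((-1:ℝ) • X) * star (T ^ n)) *
        star a := by
      rw [hCn, star_mul, star_mul, hsa, hsb, ← hbb]; noncomm_ring
    have h2 : C ^ n * star (C ^ n) = NormedSpace.exp ((2 * n : ℝ) • plog C) := by
      have : IsSelfAdjoint (C ^ n) := hCP.1.pow n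
      rw [this.star_eq, ← pow_add]
      conv_lhs => rw [← hCP.exp_plog]
      rw [exp_pow_smul]; congr 2; push_cast; ring
    have h3 : hsNorm e (plog (C ^ n * star (C ^ n))) = (2 * n : ℝ) * hsNorm e (plog C) := by
      rw [h2, plog_exp (sa_smul hCP.plog.1 _), hsNorm_smul', abs_of_nonneg (by positivity)]
    have hP2 : MemP e (T ^ n * NormedSpace.exp ((-1:ℝ) • X) * star (T ^ n)) :=
      memP_conj (hTu.pow n) hP1.2.2.2 (memP_exp (hX.smul _))
    have haP : MemP e (a * star a) := by rw [hsa, haa]; exact memP_exp hX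
    have h4 := tri (isUnit_exp' _) haP hP2
    have h5 := tri (hTu.pow n) hP1 (memP_exp (hX.smul (-1)))
    rw [← h1, h3, hsa, haa, plog_exp hX.1] at h4
    rw [hXn] at h5
    linarith
  by_contra hcon
  push Not at hcon
  obtain ⟨n, hn⟩ := exists_nat_gt (2 * hsNorm e X /
    (2 * hsNorm e (plog C) - hsNorm e (plog (T * star T))))
  rw [div_lt_iff₀ (by linarith)] at hn
  have := key n
  linarith

lemma iter_doubling {e : HilbertBasis ι ℂ H} {X Y : H →L[ℂ] H} (hX : MemS2 e X) (hY : MemS2 e Y)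
    (n : ℕ) : (2:ℝ) ^ n * phi e (((2:ℝ) ^ n)⁻¹ • X) (((2:ℝ) ^ n)⁻¹ • Y) ≤ phi e X Y := by
  induction n with
  | zero => simp
  | succ n ih =>
    have h := doubling (hX.smul (((2:ℝ) ^ (n + 1))⁻¹)) (hY.smul (((2:ℝ) ^ (n + 1))⁻¹))
    have h2 : (2:ℝ) * ((2:ℝ) ^ (n + 1))⁻¹ = ((2:ℝ) ^ n)⁻¹ := by rw [pow_succ]; field_simp
    rw [smul_smul, smul_smul, h2] at h
    refine le_trans ?_ ih
    rw [pow_succ, mul_assoc]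
    rw [← pow_succ]
    gcongr

lemma scalar_log {t : ℝ} (ht : |t - 1| ≤ 1 / 2) : |Real.log t - (t - 1)| ≤ 2 * |t - 1| ^ 2 := by
  rw [abs_le] at ht
  have h0 : 0 < t := by linarith
  have h1 := Real.log_le_sub_one_of_pos h0
  have h2 := Real.one_sub_inv_le_log_of_pos h0
  rw [abs_of_nonpos (by linarith), sq_abs]
  have h3 : t - 1 - (1 - t⁻¹) = (t - 1) ^ 2 * t⁻¹ := by field_simp; try ring
  have h4 : t⁻¹ ≤ 2 := by
    rw [inv_le_comm₀ h0 (by norm_num)]; linarith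
  nlinarith [sq_nonneg (t - 1)]

lemma norm_plog_sub {B : H →L[ℂ] H} (hB : IsSelfAdjoint B) (h : ‖B - 1‖ ≤ 1 / 2) :
    ‖plog B - (B - 1)‖ ≤ 2 * ‖B - 1‖ ^ 2 := by
  have hsp : ∀ t ∈ spectrum ℝ B, |t - 1| ≤ ‖B - 1‖ := by
    intro t ht
    apply spec_abs_le
    have : t - 1 ∈ spectrum ℝ (B - algebraMap ℝ (H →L[ℂ] H) 1) := by
      rw [← spectrum.sub_singleton_eq]
      exact Set.sub_mem_sub ht rfl
    simpa using this
  have hpos : ∀ t ∈ spectrum ℝ B, t ≠ 0 := by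
    intro t ht
    have := (abs_le.1 ((hsp t ht).trans h)).1
    intro h0; rw [h0] at this; norm_num at this
  have hl : ContinuousOn Real.log (spectrum ℝ B) :=
    Real.continuousOn_log.mono fun t ht => hpos t ht
  have h1 : plog B - (B - 1) = cfc (fun t : ℝ => Real.log t - (t - 1)) B := by
    rw [cfc_sub Real.log (fun t => t - 1) B hl, cfc_sub (fun t => t) (fun _ => 1) B, cfc_id' ℝ B,
      cfc_const_one ℝ B]
    rfl
  rw [h1]
  refine norm_cfc_le (by positivity) fun t ht => ?_
  have h2 := hsp t ht
  refine (scalar_log (h2.trans h)).trans ?_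
  gcongr

lemma hasDerivAt_curve (X Y : H →L[ℂ] H) :
    HasDerivAt (fun s : ℝ => NormedSpace.exp ((-(2:ℝ)⁻¹) • (s • X)) * NormedSpace.exp (s • Y) *
      NormedSpace.exp ((-(2:ℝ)⁻¹) • (s • X))) (Y - X) 0 := by
  have hd : ∀ Z : H →L[ℂ] H, HasDerivAt (fun s : ℝ => NormedSpace.exp (s • Z)) Z 0 := by
    intro Z
    have := hasDerivAt_exp_smul_const (𝕂 := ℝ) Z (0:ℝ)
    simpa using this
  have h1 : HasDerivAt (fun s : ℝ => NormedSpace.exp ((-(2:ℝ)⁻¹) • (s • X)))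
      ((-(2:ℝ)⁻¹) • X) 0 := by
    have he : (fun s : ℝ => NormedSpace.exp ((-(2:ℝ)⁻¹) • (s • X)))
        = fun s : ℝ => NormedSpace.exp (s • ((-(2:ℝ)⁻¹) • X)) := by
      funext s; rw [smul_comm]
    rw [he]; exact hd _
  have h2 := hd Y
  have h3 := (h1.mul h2).mul h1
  refine h3.congr_deriv ?_
  simp
  module

/-- Exponential metric increasing property. -/
lemma emi {e : HilbertBasis ι ℂ H} {X Y : H →L[ℂ] H} (hX : MemS2 e X) (hY : MemS2 e Y) :
    hsNorm e (Y - X) ≤ phi e X Y := by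
  set B : ℝ → (H →L[ℂ] H) := fun s => NormedSpace.exp ((-(2:ℝ)⁻¹) • (s • X)) *
    NormedSpace.exp (s • Y) * NormedSpace.exp ((-(2:ℝ)⁻¹) • (s • X)) with hB
  have hBP : ∀ s, MemP e (B s) := fun s =>
    memP_exp_conj ((hX.smul s).smul _) (memP_exp (hY.smul s))
  have hB0 : B 0 = 1 := by simp [hB]
  have hd : HasDerivAt B (Y - X) 0 := hasDerivAt_curve X Y
  have hε : Tendsto (fun n : ℕ => ((2:ℝ) ^ n)⁻¹) atTop (𝓝[≠] 0) := by
    refine tendsto_nhdsWithin_iff.2 ⟨?_, Eventually.of_forall fun n => ?_⟩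
    · simpa using tendsto_pow_atTop_nhds_zero_of_lt_one (r := (2:ℝ)⁻¹) (by norm_num) (by norm_num)
    · simp
  have hslope : Tendsto (fun n : ℕ => (2:ℝ) ^ n • (B ((2:ℝ) ^ n)⁻¹ - 1)) atTop (𝓝 (Y - X)) := by
    have := (hasDerivAt_iff_tendsto_slope.1 hd).comp hε
    refine this.congr fun n => ?_
    simp [slope, hB0]
  have hB1 : Tendsto (fun n : ℕ => ‖B ((2:ℝ) ^ n)⁻¹ - 1‖) atTop (𝓝 0) := by
    have h1 : Tendsto B (𝓝 0) (𝓝 (B 0)) := hd.continuousAt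
    have h2 := h1.comp (hε.mono_right nhdsWithin_le_nhds)
    rw [hB0] at h2
    simpa using (h2.sub_const 1).norm
  have herr : Tendsto (fun n : ℕ => (2:ℝ) ^ n • (plog (B ((2:ℝ) ^ n)⁻¹) - (B ((2:ℝ) ^ n)⁻¹ - 1)))
      atTop (𝓝 0) := by
    have h1 : Tendsto (fun n : ℕ => 2 * (‖(2:ℝ) ^ n • (B ((2:ℝ) ^ n)⁻¹ - 1)‖ *
        ‖B ((2:ℝ) ^ n)⁻¹ - 1‖)) atTop (𝓝 0) := by
      simpa using (hslope.norm.mul hB1).const_mul 2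
    refine squeeze_zero_norm' ?_ h1
    filter_upwards [hB1.eventually (ge_mem_nhds (show (0:ℝ) < 1 / 2 by norm_num))] with n hn
    rw [norm_smul, norm_smul]
    have := norm_plog_sub (hBP _).1 hn
    have h2 : 0 ≤ ‖(2:ℝ) ^ n‖ := norm_nonneg _
    nlinarith
  have hlim : Tendsto (fun n : ℕ => (2:ℝ) ^ n • plog (B ((2:ℝ) ^ n)⁻¹)) atTop (𝓝 (Y - X)) := by
    have := herr.add hslope
    rw [zero_add] at this
    refine this.congr fun n => ?_
    rw [← smul_add]; congr 1; abel
  refine hsNorm_le_of_tendsto e (fun n => ((hBP _).plog.smul _).2) hlim fun n => ?_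
  rw [hsNorm_smul', abs_of_nonneg (by positivity)]
  exact iter_doubling hX hY n

/-! ### The semi-parallelogram law -/

lemma gdist_eq {e : HilbertBasis ι ℂ H} {p q g gi : H →L[ℂ] H} (hp : MemP e p) (hq : MemP e q)
    (hgp : g * star g = p) (h1 : g * gi = 1) (h2 : gi * g = 1) :
    gdist e p q = hsNorm e (plog (gi * q * star gi)) := by
  subst hgp
  have hg : IsUnit g := ⟨⟨g, gi, h1, h2⟩, rfl⟩
  obtain ⟨v, hv, hgv⟩ := polar hg hp
  have hL := hp.plog
  have hpi : pinvsqrt (g * star g) = NormedSpace.exp ((-(2:ℝ)⁻¹) • plog (g * star g)) := by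
    conv_lhs => rw [← hp.exp_plog]
    rw [pinvsqrt_exp hL.1]
  set L := plog (g * star g) with hLd
  set b := NormedSpace.exp ((-(2:ℝ)⁻¹) • L) with hb
  have hsb : star b = b := (sa_exp (sa_smul hL.1 _)).star_eq
  have hba : b * NormedSpace.exp ((2:ℝ)⁻¹ • L) = 1 := by rw [hb, exp_mul_exp_smul]; simp
  have hgi : gi = star v * b := by
    refine (left_inv_eq_right_inv (a := g) ?_ h1).symm
    rw [hgv]
    calc _ = star v * (b * NormedSpace.exp ((2:ℝ)⁻¹ • L)) * v := by noncomm_ring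
      _ = 1 := by rw [hba, mul_one, Unitary.star_mul_self_of_mem hv]
  have hP : MemP e (b * q * b) := memP_exp_conj (hL.smul _) hq
  unfold gdist
  rw [hpi, ← norm_plog_unitary (Unitary.star_mem hv) hP, hgi, star_mul, hsb]
  congr 2

lemma hs_parallelogram {e : HilbertBasis ι ℂ H} {V W : H →L[ℂ] H} (hV : IsHS e V)
    (hW : IsHS e W) :
    hsNorm e (V - W) ^ 2 + hsNorm e (-V - W) ^ 2 = 2 * hsNorm e V ^ 2 + 2 * hsNorm e W ^ 2 := by
  rw [hsNorm_sq, hsNorm_sq, hsNorm_sq, hsNorm_sq, ← tsum_mul_left, ← tsum_mul_left,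
    ← Summable.tsum_add (hV.sub' hW) (hV.neg'.sub' hW),
    ← Summable.tsum_add (Summable.mul_left 2 hV) (Summable.mul_left 2 hW)]
  refine tsum_congr fun i => ?_
  have h := parallelogram_law_with_norm ℂ (V (e i)) (W (e i))
  have h2 : ‖(-V - W) (e i)‖ = ‖V (e i) + W (e i)‖ := by
    rw [← norm_neg]; simp [add_comm]
  rw [h2, ContinuousLinearMap.sub_apply]
  nlinarith


/-- **semi-parallelogram law.** For `p, q₁, q₂ ∈ P` and `m` the geodesic
midpoint of `q₁` and `q₂`, one has
`d(p,q₁)² + d(p,q₂)² ≥ ½ d(q₁,q₂)² + 2 d(p,m)²`. -/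
theorem statement9 (e : HilbertBasis ι ℂ H) (p q₁ q₂ : H →L[ℂ] H)
    (hp : MemP e p) (hq₁ : MemP e q₁) (hq₂ : MemP e q₂) :
    (2:ℝ)⁻¹ * gdist e q₁ q₂ ^ 2 + 2 * gdist e p (geodesic q₁ q₂ (2:ℝ)⁻¹) ^ 2 ≤
      gdist e p q₁ ^ 2 + gdist e p q₂ ^ 2 := by
  have hL := hq₁.plog
  have hpi : pinvsqrt q₁ = NormedSpace.exp ((-(2:ℝ)⁻¹) • plog q₁) := by
    conv_lhs => rw [← hq₁.exp_plog]
    rw [pinvsqrt_exp hL.1]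
  have hps : psqrt q₁ = NormedSpace.exp ((2:ℝ)⁻¹ • plog q₁) := by
    conv_lhs => rw [← hq₁.exp_plog]
    rw [psqrt_exp hL.1]
  have hq1e : q₁ = psqrt q₁ * psqrt q₁ := by
    rw [hps, exp_mul_exp_smul]
    conv_lhs => rw [← hq₁.exp_plog]
    norm_num
  unfold geodesic geoCurve
  have hd12 : gdist e q₁ q₂ = hsNorm e (plog (pinvsqrt q₁ * q₂ * pinvsqrt q₁)) := rfl
  rw [hd12]
  have hCP : MemP e (pinvsqrt q₁ * q₂ * pinvsqrt q₁) := by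
    rw [hpi]; exact memP_exp_conj (hL.smul _) hq₂
  have hKe := hCP.exp_plog
  have hK := hCP.plog
  have hbbP : MemP e (pinvsqrt q₁ * pinvsqrt q₁) := by
    rw [hpi, exp_mul_exp_smul]; exact memP_exp (hL.smul _)
  have hab : psqrt q₁ * pinvsqrt q₁ = 1 := by rw [hps, hpi, exp_mul_exp_smul]; simp
  have hba : pinvsqrt q₁ * psqrt q₁ = 1 := by rw [hps, hpi, exp_mul_exp_smul]; simp
  have hsa : star (psqrt q₁) = psqrt q₁ := by
    rw [hps]; exact (sa_exp (sa_smul hL.1 _)).star_eq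
  have hsb : star (pinvsqrt q₁) = pinvsqrt q₁ := by
    rw [hpi]; exact (sa_exp (sa_smul hL.1 _)).star_eq
  generalize plog (pinvsqrt q₁ * q₂ * pinvsqrt q₁) = K at hKe hK ⊢
  generalize psqrt q₁ = a at *
  generalize pinvsqrt q₁ = b at *
  clear hpi hps
  set k := NormedSpace.exp ((4:ℝ)⁻¹ • K) with hk
  set j := NormedSpace.exp ((-(4:ℝ)⁻¹) • K) with hj
  have hkj : k * j = 1 := by rw [hk, hj, exp_mul_exp_smul]; simp
  have hjk : j * k = 1 := by rw [hk, hj, exp_mul_exp_smul]; simp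
  have hkk : k * k = NormedSpace.exp ((2:ℝ)⁻¹ • K) := by
    rw [hk, exp_mul_exp_smul]; congr 2; norm_num
  have hjj : j * j = NormedSpace.exp (-((2:ℝ)⁻¹ • K)) := by
    rw [hj, exp_mul_exp_smul, ← neg_smul]; congr 2; norm_num
  have hjKj : j * NormedSpace.exp K * j = NormedSpace.exp ((2:ℝ)⁻¹ • K) := by
    have h := exp_mul_exp_smul K (-(4:ℝ)⁻¹) 1
    rw [one_smul] at h
    rw [hj, h, exp_mul_exp_smul]; congr 2; norm_num
  have hsk : star k = k := (sa_exp (sa_smul hK.1 _)).star_eq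
  have hsj : star j = j := (sa_exp (sa_smul hK.1 _)).star_eq
  set m := a * NormedSpace.exp ((2:ℝ)⁻¹ • K) * a with hm
  have hggi : (a * k) * (j * b) = 1 := by
    calc _ = a * (k * j) * b := by noncomm_ring
      _ = 1 := by rw [hkj, mul_one, hab]
  have hgig : (j * b) * (a * k) = 1 := by
    calc _ = j * (b * a) * k := by noncomm_ring
      _ = 1 := by rw [hba, mul_one, hjk]
  have hsgi : star (j * b) = b * j := by rw [star_mul, hsb, hsj]
  have hsg : star (a * k) = k * a := by rw [star_mul, hsa, hsk]
  have hmg : m = (a * k) * (k * a) := by rw [hm, ← hkk]; noncomm_ring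
  have hgiP : MemP e ((j * b) * star (j * b)) := by
    have h : (j * b) * star (j * b) = j * (b * b) * j := by rw [hsgi]; noncomm_ring
    rw [h]; exact memP_exp_conj (hK.smul _) hbbP
  have hgiu : IsUnit (j * b) := ⟨⟨_, _, hgig, hggi⟩, rfl⟩
  have hgu : IsUnit (a * k) := ⟨⟨_, _, hggi, hgig⟩, rfl⟩
  have hp'P : MemP e ((j * b) * p * star (j * b)) := memP_conj hgiu hgiP.2.2.2 hp
  have hW := hp'P.plog
  have hWe := hp'P.exp_plog
  have hmP : MemP e m := by
    have haa : MemP e (a * star a) := by rw [hsa, ← hq1e]; exact hq₁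
    have := memP_conj (e := e) (g := a) ⟨⟨a, b, hab, hba⟩, rfl⟩ haa.2.2.2
      (memP_exp (hK.smul (2:ℝ)⁻¹))
    rwa [hsa] at this
  generalize plog ((j * b) * p * star (j * b)) = W at hW hWe
  set w := NormedSpace.exp ((2:ℝ)⁻¹ • W) with hw
  set x := NormedSpace.exp ((-(2:ℝ)⁻¹) • W) with hx
  have hwx : w * x = 1 := by rw [hw, hx, exp_mul_exp_smul]; simp
  have hxw : x * w = 1 := by rw [hw, hx, exp_mul_exp_smul]; simp
  have hww : w * w = NormedSpace.exp W := by rw [hw, exp_mul_exp_smul]; norm_num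
  have hxx : x * x = NormedSpace.exp (-W) := by
    rw [hx, exp_mul_exp_smul, ← neg_one_smul ℝ W]; congr 2; norm_num
  have hsw : star w = w := (sa_exp (sa_smul hW.1 _)).star_eq
  have hsx : star x = x := (sa_exp (sa_smul hW.1 _)).star_eq
  have hkabj : (k * a) * (b * j) = 1 := by
    calc _ = k * (a * b) * j := by noncomm_ring
      _ = 1 := by rw [hab, mul_one, hkj]
  have hbjka : (b * j) * (k * a) = 1 := by
    calc _ = b * (j * k) * a := by noncomm_ring
      _ = 1 := by rw [hjk, mul_one, hba]
  have hGG : (a * k * w) * star (a * k * w) = p := by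
    rw [star_mul, hsw, hsg]
    calc _ = (a * k) * (w * w) * (k * a) := by noncomm_ring
      _ = ((a * k) * (j * b)) * p * ((b * j) * (k * a)) := by
        rw [hww, hWe, hsgi]; noncomm_ring
      _ = p := by rw [hggi, hbjka, one_mul, mul_one]
  have hG1 : (a * k * w) * (x * (j * b)) = 1 := by
    calc _ = (a * k) * (w * x) * (j * b) := by noncomm_ring
      _ = 1 := by rw [hwx, mul_one, hggi]
  have hG2 : (x * (j * b)) * (a * k * w) = 1 := by
    calc _ = x * ((j * b) * (a * k)) * w := by noncomm_ring
      _ = 1 := by rw [hgig, mul_one, hxw]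
  have hdist : ∀ q, MemP e q → gdist e p q = hsNorm e (plog (x * (j * (b * q * b) * j) * x)) := by
    intro q hq
    rw [gdist_eq hp hq hGG hG1 hG2, star_mul, hsgi, hsx]
    congr 2
  have hd1 : gdist e p q₁ = phi e W (-((2:ℝ)⁻¹ • K)) := by
    rw [hdist _ hq₁]
    have h : b * q₁ * b = 1 := by
      calc _ = (b * a) * (a * b) := by rw [hq1e]; noncomm_ring
        _ = 1 := by rw [hab, hba, mul_one]
    rw [h, mul_one, hjj]; rfl
  have hd2 : gdist e p q₂ = phi e W ((2:ℝ)⁻¹ • K) := by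
    rw [hdist _ hq₂, ← hKe, hjKj]; rfl
  have hdm : gdist e p m = hsNorm e W := by
    rw [hdist _ hmP]
    have h : j * (b * m * b) * j = 1 := by
      calc _ = ((j * b) * (a * k)) * ((k * a) * (b * j)) := by rw [hmg]; noncomm_ring
        _ = 1 := by rw [hgig, hkabj, mul_one]
    rw [h, mul_one, hxx, plog_exp hW.neg.1, hsNorm_neg']
  rw [hd1, hd2, hdm]
  have hV := hK.smul (2:ℝ)⁻¹
  have e1 := emi hW hV.neg
  have e2 := emi hW hV
  have par := hs_parallelogram hV.2 hW.2
  have hVn : hsNorm e ((2:ℝ)⁻¹ • K) = (2:ℝ)⁻¹ * hsNorm e K := by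
    rw [hsNorm_smul', abs_of_nonneg (by norm_num)]
  rw [hVn] at par
  have s1 := pow_le_pow_left₀ (hsNorm_nonneg e _) e1 2
  have s2 := pow_le_pow_left₀ (hsNorm_nonneg e _) e2 2
  nlinarith
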